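/- Suppose d < δ and δ − d is odd. Then there exist subsets S_i ⊆ {1,…,a_{d+i}} with |S_i| = a_i for i = 1,…,i* such that in(I,g) is generated by: the monomials of in(I); the largest monomial of B_d; the monomials of B_{d+i}^{S_i} for i = 1,…,i*; the monomials of B_{d+i*+1}; the monomials of z^{2k−1}·B_{d+i*+1−k} for k = 1,…,i*+1; and the monomials of z^{δ−d+2j}·B_{d−j} for j = 1,…,d (where B_0 = {1}). -/

import Mathlib

open MvPolynomial

/-- The total degree of an exponent vector. -/
def expDeg {n : ℕ} (μ : Fin n →₀ ℕ) : ℕ := μ.sum fun _ e => e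

/-- Strict degree reverse lexicographic order on exponent vectors, for variables
`x_1 > ⋯ > x_n` (indexed by `Fin n` in this order). -/
def DrlLT {n : ℕ} (a b : Fin n →₀ ℕ) : Prop :=
  expDeg a < expDeg b ∨
    (expDeg a = expDeg b ∧ ∃ i : Fin n, b i < a i ∧ ∀ j : Fin n, i < j → a j = b j)

/-- `μ` is the leading (degrevlex-largest) exponent of `p`. -/
def IsLeadExp {n : ℕ} {K : Type*} [CommSemiring K] (p : MvPolynomial (Fin n) K)
    (μ : Fin n →₀ ℕ) : Prop :=
  μ ∈ p.support ∧ ∀ ν ∈ p.support, ν ≠ μ → DrlLT ν μ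

/-- The initial ideal of `I` with respect to the degree reverse lexicographic order. -/
noncomputable def initialIdeal {n : ℕ} {K : Type*} [CommRing K]
    (I : Ideal (MvPolynomial (Fin n) K)) : Ideal (MvPolynomial (Fin n) K) :=
  Ideal.span { m | ∃ p ∈ I, p ≠ 0 ∧ ∃ μ, IsLeadExp p μ ∧ m = monomial μ (1 : K) }

/-- The standard monomials of degree `i` of `I` : exponents of the monomials of degree `i`
not lying in the initial ideal of `I`. -/
def stdMon {n : ℕ} {K : Type*} [CommRing K] (I : Ideal (MvPolynomial (Fin n) K)) (i : ℕ) :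
    Set (Fin n →₀ ℕ) :=
  { μ | expDeg μ = i ∧ monomial μ (1 : K) ∉ initialIdeal I }

/-- `μ` is a minimal monomial generator of the monomial ideal `M`. -/
def IsMinGen {n : ℕ} {K : Type*} [CommRing K] (M : Ideal (MvPolynomial (Fin n) K))
    (μ : Fin n →₀ ℕ) : Prop :=
  monomial μ (1 : K) ∈ M ∧ ∀ ν : Fin n →₀ ℕ, ν ≤ μ → ν ≠ μ → monomial ν (1 : K) ∉ M

/-- `μ` satisfies property `P` with respect to the monomial ideal `M`: if `m` is the largest
index of a variable dividing `x^μ`, then every monomial of the same degree in the variables of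
index `< m` also lies in `M`. -/
def SatisfiesP {n : ℕ} {K : Type*} [CommRing K] (M : Ideal (MvPolynomial (Fin n) K))
    (μ : Fin n →₀ ℕ) : Prop :=
  ∀ m : Fin n, μ m ≠ 0 → (∀ j : Fin n, m < j → μ j = 0) →
    ∀ ν : Fin n →₀ ℕ, expDeg ν = expDeg μ → (∀ j : Fin n, m ≤ j → ν j = 0) →
      monomial ν (1 : K) ∈ M

/-- Conjecture E (Pardue) holds for the ideal `I`: every minimal generator of the initial
ideal of `I` satisfies property `P`. -/
def ConjE {n : ℕ} {K : Type*} [CommRing K] (I : Ideal (MvPolynomial (Fin n) K)) : Prop :=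
  ∀ μ, IsMinGen (initialIdeal I) μ → SatisfiesP (initialIdeal I) μ

/-- `f` is a generic sequence of forms of degrees `d i` over the base field `F`: each `f i` is
homogeneous of degree `d i` and the family of all coefficients (at all monomials of degree
`d i`) is algebraically independent over `F`. -/
def IsGenericSeq (F : Type*) {K : Type*} [CommRing F] [CommRing K] [Algebra F K]
    {n r : ℕ} (d : Fin r → ℕ) (f : Fin r → MvPolynomial (Fin n) K) : Prop :=
  (∀ i, (f i).IsHomogeneous (d i)) ∧
    AlgebraicIndependent F
      (fun p : Σ i : Fin r, { μ : Fin n →₀ ℕ // expDeg μ = d i } => (f p.1).coeff p.2.1)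

/-- The projection `K[x_1,…,x_n,z] → K[x_1,…,x_n]` sending `z` (the last variable) to `0` and
fixing the other variables. -/
noncomputable def projMap (K : Type*) [CommRing K] (n : ℕ) :
    MvPolynomial (Fin (n + 1)) K →ₐ[K] MvPolynomial (Fin n) K :=
  aeval (fun i => Fin.lastCases 0 (fun j => X j) i)

/-- Embedding of exponent vectors of `K[x_1,…,x_n]` into those of `K[x_1,…,x_n,z]`
(`z`-exponent `0`). -/
noncomputable def embExp {n : ℕ} (μ : Fin n →₀ ℕ) : Fin (n + 1) →₀ ℕ :=
  Finsupp.embDomain ⟨Fin.castSucc, Fin.castSucc_injective n⟩ μ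

/-- Multiplication by `z^c` on exponent vectors in `K[x_1,…,x_n,z]`. -/
noncomputable def zShift {n : ℕ} (c : ℕ) (μ : Fin (n + 1) →₀ ℕ) : Fin (n + 1) →₀ ℕ :=
  μ + Finsupp.single (Fin.last n) c

/-- `f` (homogeneous of degree `e`) is semi-regular on `R/I`: in each degree `t`, the
multiplication map `(R/I)_t → (R/I)_{t+e}` is injective or surjective. -/
def SemiRegularOn {vars K : Type*} [CommRing K] (I : Ideal (MvPolynomial vars K))
    (f : MvPolynomial vars K) (e : ℕ) : Prop :=
  ∀ t : ℕ,
    (∀ p ∈ homogeneousSubmodule vars K t, f * p ∈ I → p ∈ I) ∨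
    (∀ q ∈ homogeneousSubmodule vars K (t + e),
      ∃ p ∈ homogeneousSubmodule vars K t, q - f * p ∈ I)

/-- The degree-`t` graded piece of `R/I`, as a `K`-submodule of the quotient. -/
noncomputable def quotDegPart {vars K : Type*} [CommRing K] (I : Ideal (MvPolynomial vars K))
    (t : ℕ) : Submodule K (MvPolynomial vars K ⧸ I) :=
  (homogeneousSubmodule vars K t).map (Ideal.Quotient.mkₐ K I).toLinearMap

/-- A finite linearly independent family of vectors in a coordinate space has a nonzero maximal
minor. -/
theorem exists_det_ne_zero_of_linearIndependent {K κ β : Type*} [Field K] [Fintype κ]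
    [DecidableEq κ] [Finite β] (v : κ → β → K) (h : LinearIndependent K v) :
    ∃ e : κ → β, (Matrix.of fun i j => v i (e j)).det ≠ 0 := by
  classical
  have := Fintype.ofFinite β
  let A : Matrix κ β K := Matrix.of v
  have hrank : A.rank = Fintype.card κ := LinearIndependent.rank_matrix (M := A) h
  obtain ⟨κ', a, -, hsp, hli⟩ := exists_linearIndependent' K A.col
  have hfin : Module.finrank K (Submodule.span K (Set.range A.col)) = Fintype.card κ := by
    rw [← hrank, Matrix.rank_eq_finrank_span_cols]
  have : Finite κ' := hli.finite
  have := Fintype.ofFinite κ'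
  have hcard : Fintype.card κ' = Fintype.card κ := by
    rw [← hfin, ← hsp, finrank_span_eq_card hli]
  let eqv := Fintype.equivOfCardEq hcard.symm
  refine ⟨fun j => a (eqv j), ?_⟩
  have hli' : LinearIndependent K (fun j => A.col (a (eqv j))) :=
    hli.comp eqv eqv.injective
  have h2 : IsUnit (Matrix.of fun i j => v i (a (eqv j))) :=
    Matrix.linearIndependent_cols_iff_isUnit.mp hli'
  exact ((Matrix.isUnit_iff_isUnit_det _).mp h2).ne_zero

/-- Linear independence of vectors with polynomial coordinates passes from an arbitrary parameter
point to an algebraically independent one. -/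
theorem linearIndependent_aeval_of_algebraicIndependent {F K ι κ β : Type*} [Field F] [Field K]
    [Algebra F K] [Finite κ] [Finite β] {c : ι → K} (hc : AlgebraicIndependent F c) (c' : ι → K)
    (M : κ → β → MvPolynomial ι F)
    (h : LinearIndependent K fun i b => aeval c' (M i b)) :
    LinearIndependent K fun i b => aeval c (M i b) := by
  classical
  have := Fintype.ofFinite κ
  obtain ⟨e, he⟩ := exists_det_ne_zero_of_linearIndependent _ h
  let Q : Matrix κ κ (MvPolynomial ι F) := Matrix.of fun i j => M i (e j)
  have hQ : ∀ x : ι → K, aeval x Q.det = (Matrix.of fun i j => aeval x (M i (e j))).det := by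
    intro x
    rw [AlgHom.map_det]
    rfl
  have hne : aeval c Q.det ≠ 0 := by
    intro h0
    have hz : Q.det = 0 := by
      apply hc
      rw [h0, map_zero]
    apply he
    rw [← hQ c', hz, map_zero]
  rw [hQ] at hne
  have h1 : LinearIndependent K (Matrix.of fun i j => aeval c (M i (e j))).row :=
    Matrix.linearIndependent_rows_iff_isUnit.mpr
      ((Matrix.isUnit_iff_isUnit_det _).mpr hne.isUnit)
  exact LinearIndependent.of_comp (LinearMap.funLeft K K e) h1

theorem expDeg_eq_degree {n : ℕ} (μ : Fin n →₀ ℕ) : expDeg μ = μ.degree := rfl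

theorem expDeg_add {n : ℕ} (μ ν : Fin n →₀ ℕ) : expDeg (μ + ν) = expDeg μ + expDeg ν :=
  map_add Finsupp.degree μ ν

theorem expDeg_single {n : ℕ} (i : Fin n) (k : ℕ) : expDeg (Finsupp.single i k) = k :=
  Finsupp.degree_single i k

theorem finite_setOf_expDeg_eq (n t : ℕ) : {μ : Fin n →₀ ℕ | expDeg μ = t}.Finite :=
  Finsupp.finite_of_degree_eq t

instance finite_expDeg_subtype (n t : ℕ) : Finite {μ : Fin n →₀ ℕ // expDeg μ = t} :=
  finite_setOf_expDeg_eq n t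

instance finite_homogeneousSubmodule {σ K : Type*} [Finite σ] [CommRing K] (t : ℕ) :
    Module.Finite K (homogeneousSubmodule σ K t) :=
  Module.Finite.iff_fg.mpr (homogeneousSubmodule_fg _ _ t)

theorem expDeg_eq_of_mem_support {n : ℕ} {K : Type*} [CommRing K] {p : MvPolynomial (Fin n) K}
    {t : ℕ} (hp : p.IsHomogeneous t) {μ : Fin n →₀ ℕ} (hμ : μ ∈ p.support) : expDeg μ = t := by
  by_contra h
  exact (mem_support_iff.mp hμ) (hp.coeff_eq_zero h)

theorem homogeneousSubmodule_eq_span_monomial (n : ℕ) (K : Type*) [CommRing K] (t : ℕ) :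
    homogeneousSubmodule (Fin n) K t =
      Submodule.span K ((fun μ => monomial μ (1 : K)) '' {μ | expDeg μ = t}) := by
  apply le_antisymm
  · intro p hp
    rw [p.as_sum]
    refine Submodule.sum_mem _ fun μ hμ => ?_
    have : monomial μ (coeff μ p) = coeff μ p • monomial μ (1 : K) := by
      rw [smul_monomial, smul_eq_mul, mul_one]
    rw [this]
    exact Submodule.smul_mem _ _ (Submodule.subset_span ⟨μ, expDeg_eq_of_mem_support hp hμ, rfl⟩)
  · rw [Submodule.span_le]
    rintro _ ⟨μ, hμ, rfl⟩
    exact isHomogeneous_monomial _ hμ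

theorem homogeneousComponent_mul_of_isHomogeneous {σ K : Type*} [CommRing K]
    {f : MvPolynomial σ K} {e : ℕ} (hf : f.IsHomogeneous e) (a : MvPolynomial σ K) (t : ℕ) :
    homogeneousComponent t (a * f) =
      if e ≤ t then homogeneousComponent (t - e) a * f else 0 := by
  conv_lhs => rw [← sum_homogeneousComponent a, Finset.sum_mul, map_sum]
  have h1 : ∀ j, homogeneousComponent t (homogeneousComponent j a * f) =
      if t = j + e then homogeneousComponent j a * f else 0 := fun j => by
    have := homogeneousComponent_of_mem (m := t) (n := j + e)
      (p := homogeneousComponent j a * f)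
      ((homogeneousComponent_isHomogeneous j a).mul hf)
    rw [this]
  simp_rw [h1]
  split_ifs with h
  · have h2 : ∀ j, (t = j + e) ↔ (t - e = j) := fun j => by omega
    simp_rw [h2]
    rw [Finset.sum_ite_eq]
    split_ifs with h3
    · rfl
    · rw [homogeneousComponent_eq_zero, zero_mul]
      simp only [Finset.mem_range] at h3
      omega
  · exact Finset.sum_eq_zero fun j _ => if_neg (by omega)

/-- An ideal is closed under taking homogeneous components. -/
def HasComponents {σ K : Type*} [CommRing K] (I : Ideal (MvPolynomial σ K)) : Prop :=
  ∀ p ∈ I, ∀ t, homogeneousComponent t p ∈ I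

theorem hasComponents_span_range {ι σ K : Type*} [Fintype ι] [CommRing K] {d : ι → ℕ}
    {f : ι → MvPolynomial σ K} (hf : ∀ i, (f i).IsHomogeneous (d i)) :
    HasComponents (Ideal.span (Set.range f)) := by
  intro p hp t
  obtain ⟨c, rfl⟩ := Ideal.mem_span_range_iff_exists_fun.mp hp
  rw [map_sum]
  refine Ideal.sum_mem _ fun i _ => ?_
  rw [homogeneousComponent_mul_of_isHomogeneous (hf i)]
  split_ifs
  · exact Ideal.mul_mem_left _ _ (Ideal.subset_span ⟨i, rfl⟩)
  · exact Ideal.zero_mem _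

theorem HasComponents.sup {σ K : Type*} [CommRing K] {I J : Ideal (MvPolynomial σ K)}
    (hI : HasComponents I) (hJ : HasComponents J) : HasComponents (I ⊔ J) := by
  intro p hp t
  obtain ⟨a, ha, b, hb, rfl⟩ := Submodule.mem_sup.mp hp
  rw [map_add]
  exact Ideal.add_mem _ (Ideal.mem_sup_left (hI a ha t)) (Ideal.mem_sup_right (hJ b hb t))

theorem hasComponents_span_singleton {σ K : Type*} [CommRing K] {q : MvPolynomial σ K} {e : ℕ}
    (hq : q.IsHomogeneous e) : HasComponents (Ideal.span {q}) := by
  have := hasComponents_span_range (ι := Unit) (d := fun _ => e) (f := fun _ => q) fun _ => hq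
  simpa using this

/-- The degree `t` part of an ideal. -/
noncomputable def homPart {σ K : Type*} [CommRing K] (I : Ideal (MvPolynomial σ K)) (t : ℕ) :
    Submodule K (MvPolynomial σ K) :=
  I.restrictScalars K ⊓ homogeneousSubmodule σ K t

theorem mem_homPart {σ K : Type*} [CommRing K] {I : Ideal (MvPolynomial σ K)} {t : ℕ}
    {p : MvPolynomial σ K} : p ∈ homPart I t ↔ p ∈ I ∧ p.IsHomogeneous t := Iff.rfl

theorem homPart_le {σ K : Type*} [CommRing K] (I : Ideal (MvPolynomial σ K)) (t : ℕ) :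
    homPart I t ≤ homogeneousSubmodule σ K t := inf_le_right

theorem homPart_mono {σ K : Type*} [CommRing K] {I J : Ideal (MvPolynomial σ K)} (h : I ≤ J)
    (t : ℕ) : homPart I t ≤ homPart J t := fun _ hp => ⟨h hp.1, hp.2⟩

instance finite_homPart {σ K : Type*} [Finite σ] [Field K] (I : Ideal (MvPolynomial σ K))
    (t : ℕ) : Module.Finite K (homPart I t) :=
  Submodule.finiteDimensional_of_le (homPart_le I t)

/-- A homogeneous element of `I + (q)` is congruent modulo `I` to a homogeneous multiple of `q`. -/
theorem exists_of_mem_sup_span_singleton {σ K : Type*} [CommRing K]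
    {I : Ideal (MvPolynomial σ K)} (hI : HasComponents I) {q : MvPolynomial σ K} {e : ℕ}
    (hq : q.IsHomogeneous e) {p : MvPolynomial σ K} {t : ℕ} (hp : p.IsHomogeneous t)
    (hmem : p ∈ I ⊔ Ideal.span {q}) :
    p ∈ I ∨ ∃ s, s + e = t ∧ ∃ r : MvPolynomial σ K, r.IsHomogeneous s ∧ p - q * r ∈ I := by
  obtain ⟨a, ha, b, hb, rfl⟩ := Submodule.mem_sup.mp hmem
  obtain ⟨c, rfl⟩ := Ideal.mem_span_singleton'.mp hb
  have h1 := homogeneousComponent_eq_self hp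
  rw [map_add, homogeneousComponent_mul_of_isHomogeneous hq] at h1
  split_ifs at h1 with h
  · right
    refine ⟨t - e, by omega, _, homogeneousComponent_isHomogeneous (t - e) c, ?_⟩
    rw [← h1, mul_comm q, add_sub_cancel_right]
    exact hI a ha t
  · left
    rw [← h1, add_zero]
    exact hI a ha t

/-- Homogeneous multipliers of degree `s` that `q` carries into `I`. -/
noncomputable def colonPart {σ K : Type*} [CommRing K] (I : Ideal (MvPolynomial σ K))
    (q : MvPolynomial σ K) (s : ℕ) : Submodule K (MvPolynomial σ K) :=
  (I.restrictScalars K).comap (LinearMap.mulLeft K q) ⊓ homogeneousSubmodule σ K s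

theorem mem_colonPart {σ K : Type*} [CommRing K] {I : Ideal (MvPolynomial σ K)}
    {q p : MvPolynomial σ K} {s : ℕ} :
    p ∈ colonPart I q s ↔ q * p ∈ I ∧ p.IsHomogeneous s := Iff.rfl

theorem homPart_le_colonPart {σ K : Type*} [CommRing K] (I : Ideal (MvPolynomial σ K))
    (q : MvPolynomial σ K) (s : ℕ) : homPart I s ≤ colonPart I q s :=
  fun _ hp => ⟨I.mul_mem_left q hp.1, hp.2⟩

instance finite_colonPart {σ K : Type*} [Finite σ] [Field K] (I : Ideal (MvPolynomial σ K))
    (q : MvPolynomial σ K) (s : ℕ) : Module.Finite K (colonPart I q s) :=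
  Submodule.finiteDimensional_of_le (inf_le_right : _ ≤ homogeneousSubmodule σ K s)

/-- Dimension count for adding one form to a homogeneous ideal. -/
theorem finrank_homPart_sup_span_singleton {σ K : Type*} [Finite σ] [Field K]
    {I : Ideal (MvPolynomial σ K)} (hI : HasComponents I) {q : MvPolynomial σ K} {e : ℕ}
    (hq : q.IsHomogeneous e) (s : ℕ) :
    Module.finrank K (homPart (I ⊔ Ideal.span {q}) (s + e)) +
        Module.finrank K (colonPart I q s) =
      Module.finrank K (homPart I (s + e)) +
        Module.finrank K (homogeneousSubmodule σ K s) := by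
  let ψ : (homogeneousSubmodule σ K s × homPart I (s + e)) →ₗ[K] MvPolynomial σ K :=
    LinearMap.coprod ((LinearMap.mulLeft K q).comp (Submodule.subtype _)) (Submodule.subtype _)
  have hψ : ∀ x, ψ x = q * x.1 + x.2 := fun x => rfl
  have hrange : LinearMap.range ψ = homPart (I ⊔ Ideal.span {q}) (s + e) := by
    apply le_antisymm
    · rintro _ ⟨x, rfl⟩
      rw [hψ]
      refine mem_homPart.mpr ⟨Ideal.add_mem _ (Ideal.mem_sup_right ?_) (Ideal.mem_sup_left x.2.2.1),
        IsHomogeneous.add ?_ x.2.2.2⟩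
      · exact Ideal.mul_mem_right _ _ (Ideal.mem_span_singleton_self q)
      · rw [mul_comm]
        exact IsHomogeneous.mul x.1.2 hq
    · intro p hp
      obtain h | ⟨s', hs', r, hr, h⟩ := exists_of_mem_sup_span_singleton hI hq hp.2 hp.1
      · exact ⟨(0, ⟨p, h, hp.2⟩), by rw [hψ]; simp⟩
      · obtain rfl : s' = s := by omega
        refine ⟨(⟨r, hr⟩, ⟨p - q * r, h, IsHomogeneous.sub hp.2 ?_⟩), by rw [hψ]; simp⟩
        rw [mul_comm]
        exact hr.mul hq
  have hker : Module.finrank K (LinearMap.ker ψ) = Module.finrank K (colonPart I q s) := by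
    let θ : LinearMap.ker ψ →ₗ[K] MvPolynomial σ K :=
      (Submodule.subtype _).comp ((LinearMap.fst K _ _).comp (Submodule.subtype _))
    have hθ : Function.Injective θ := by
      rw [injective_iff_map_eq_zero]
      rintro ⟨⟨⟨a, ha⟩, ⟨b, hb⟩⟩, hx⟩ h0
      have h0' : a = 0 := h0
      subst h0'
      have hx' : q * 0 + b = 0 := hx
      rw [mul_zero, zero_add] at hx'
      subst hx'
      rfl
    have hr : LinearMap.range θ = colonPart I q s := by
      apply le_antisymm
      · rintro _ ⟨⟨⟨⟨a, ha⟩, ⟨b, hb⟩⟩, hx⟩, rfl⟩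
        have hx' : q * a + b = 0 := hx
        refine mem_colonPart.mpr ⟨?_, ha⟩
        change q * a ∈ I
        rw [eq_neg_of_add_eq_zero_left hx']
        exact I.neg_mem hb.1
      · intro p hp
        refine ⟨⟨(⟨p, hp.2⟩, ⟨-(q * p), I.neg_mem hp.1, ?_⟩), ?_⟩, rfl⟩
        · refine Submodule.neg_mem _ ?_
          rw [mul_comm]
          exact IsHomogeneous.mul hp.2 hq
        · rw [LinearMap.mem_ker, hψ]
          simp
    rw [← hr, LinearMap.finrank_range_of_inj hθ]
  have := LinearMap.finrank_range_add_finrank_ker ψ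
  rw [hrange, hker, Module.finrank_prod] at this
  omega

/-- A family of forms whose coefficients are algebraically independent over `F`. -/
def IsGenericFamily (F : Type*) {K ι : Type*} [CommRing F] [CommRing K] [Algebra F K]
    {n : ℕ} (d : ι → ℕ) (f : ι → MvPolynomial (Fin n) K) : Prop :=
  (∀ i, (f i).IsHomogeneous (d i)) ∧
    AlgebraicIndependent F
      (fun p : Σ i : ι, { μ : Fin n →₀ ℕ // expDeg μ = d i } => (f p.1).coeff p.2.1)

theorem IsGenericFamily.comp {F K ι ι' : Type*} [CommRing F] [CommRing K] [Algebra F K]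
    {n : ℕ} {d : ι → ℕ} {f : ι → MvPolynomial (Fin n) K} (h : IsGenericFamily F d f)
    {e : ι' → ι} (he : Function.Injective e) :
    IsGenericFamily F (d ∘ e) (f ∘ e) := by
  refine ⟨fun i => h.1 (e i), ?_⟩
  refine h.2.comp (fun p : Σ i : ι', { μ : Fin n →₀ ℕ // expDeg μ = d (e i) } =>
    (⟨e p.1, p.2⟩ : Σ i : ι, { μ : Fin n →₀ ℕ // expDeg μ = d i })) ?_
  rintro ⟨i, μ⟩ ⟨j, ν⟩ hij
  obtain rfl : i = j := he (congrArg Sigma.fst hij)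
  simpa using hij

/-- The degree `t` monomial multiples of the forms `f i`, together with the monomials in `Z`. -/
noncomputable def multiplesFamily {ι K : Type*} [CommRing K] {n : ℕ} (d : ι → ℕ)
    (f : ι → MvPolynomial (Fin n) K) (t : ℕ) (Z : Set (Fin n →₀ ℕ)) :
    { x : ι × (Fin n →₀ ℕ) // expDeg x.2 + d x.1 = t } ⊕ Z → MvPolynomial (Fin n) K :=
  Sum.elim (fun x => monomial x.1.2 1 * f x.1.1) (fun ζ => monomial ζ.1 1)

theorem homPart_span_range {ι K : Type*} [Fintype ι] [CommRing K] {n : ℕ} {d : ι → ℕ}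
    {f : ι → MvPolynomial (Fin n) K} (hf : ∀ i, (f i).IsHomogeneous (d i)) (t : ℕ) :
    homPart (Ideal.span (Set.range f)) t = Submodule.span K (Set.range
      fun x : { x : ι × (Fin n →₀ ℕ) // expDeg x.2 + d x.1 = t } =>
        monomial x.1.2 (1 : K) * f x.1.1) := by
  apply le_antisymm
  · rintro p ⟨hp, hpt⟩
    obtain ⟨c, hc⟩ := Ideal.mem_span_range_iff_exists_fun.mp hp
    have h1 := homogeneousComponent_eq_self hpt
    rw [← h1, ← hc, map_sum]
    refine Submodule.sum_mem _ fun i _ => ?_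
    rw [homogeneousComponent_mul_of_isHomogeneous (hf i)]
    split_ifs with hd
    · have h2 : homogeneousComponent (t - d i) (c i) ∈ homogeneousSubmodule (Fin n) K (t - d i) :=
        homogeneousComponent_isHomogeneous _ _
      rw [homogeneousSubmodule_eq_span_monomial] at h2
      generalize homogeneousComponent (t - d i) (c i) = q at h2
      induction h2 using Submodule.span_induction with
      | mem x hx =>
        obtain ⟨μ, hμ, rfl⟩ := hx
        exact Submodule.subset_span ⟨⟨(i, μ), by simp only [Set.mem_ofPred_eq] at hμ; simp only; omega⟩, rfl⟩
      | zero => rw [zero_mul]; exact Submodule.zero_mem _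
      | add x y _ _ hx hy => rw [add_mul]; exact Submodule.add_mem _ hx hy
      | smul a x _ hx => rw [smul_mul_assoc]; exact Submodule.smul_mem _ _ hx
    · exact Submodule.zero_mem _
  · rw [Submodule.span_le]
    rintro _ ⟨x, rfl⟩
    refine mem_homPart.mpr ⟨Ideal.mul_mem_left _ _ (Ideal.subset_span ⟨_, rfl⟩), ?_⟩
    have := (isHomogeneous_monomial (d := x.1.2) (1 : K) rfl).mul (hf x.1.1)
    rwa [← expDeg_eq_degree, x.2] at this

theorem span_range_multiplesFamily {ι K : Type*} [Fintype ι] [CommRing K] {n : ℕ} {d : ι → ℕ}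
    {f : ι → MvPolynomial (Fin n) K} (hf : ∀ i, (f i).IsHomogeneous (d i)) (t : ℕ)
    (Z : Set (Fin n →₀ ℕ)) :
    Submodule.span K (Set.range (multiplesFamily d f t Z)) =
      homPart (Ideal.span (Set.range f)) t ⊔
        Submodule.span K ((fun μ => monomial μ (1 : K)) '' Z) := by
  rw [homPart_span_range hf, multiplesFamily, Set.Sum.elim_range, Submodule.span_union]
  congr 2
  ext p
  simp

theorem linearIndependent_coeff {K κ : Type*} [Field K] {n t : ℕ}
    {v : κ → MvPolynomial (Fin n) K} (hv : ∀ k, (v k).IsHomogeneous t)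
    (h : LinearIndependent K v) :
    LinearIndependent K fun k (b : {μ : Fin n →₀ ℕ // expDeg μ = t}) => coeff b.1 (v k) := by
  let φ : MvPolynomial (Fin n) K →ₗ[K] ({μ : Fin n →₀ ℕ // expDeg μ = t} → K) :=
    LinearMap.pi fun b => lcoeff K b.1
  refine h.map (f := φ) ?_
  have h1 : Submodule.span K (Set.range v) ≤ homogeneousSubmodule (Fin n) K t := by
    rw [Submodule.span_le]
    rintro _ ⟨k, rfl⟩
    exact hv k
  rw [Submodule.disjoint_def]
  intro p hp hp0
  ext μ
  rw [coeff_zero]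
  by_cases hμ : expDeg μ = t
  · exact congrFun (LinearMap.mem_ker.mp hp0) ⟨μ, hμ⟩
  · exact IsHomogeneous.coeff_eq_zero (h1 hp) hμ

/-- Semicontinuity: generic forms generate at least as much in each degree as any forms of the same
degrees, also modulo a fixed set of monomials. -/
theorem finrank_homPart_sup_le_of_generic {F K ι : Type*} [Field F] [Field K] [Algebra F K]
    [Fintype ι] {n : ℕ} {d : ι → ℕ} {f f' : ι → MvPolynomial (Fin n) K}
    (hf : IsGenericFamily F d f) (hf' : ∀ i, (f' i).IsHomogeneous (d i)) (t : ℕ)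
    (Z : Set (Fin n →₀ ℕ)) (hZ : ∀ ζ ∈ Z, expDeg ζ = t) :
    Module.finrank K (homPart (Ideal.span (Set.range f')) t ⊔
        Submodule.span K ((fun μ => monomial μ (1 : K)) '' Z) : Submodule K _) ≤
      Module.finrank K (homPart (Ideal.span (Set.range f)) t ⊔
        Submodule.span K ((fun μ => monomial μ (1 : K)) '' Z) : Submodule K _) := by
  classical
  rw [← span_range_multiplesFamily hf', ← span_range_multiplesFamily hf.1]
  have hhom : ∀ g : ι → MvPolynomial (Fin n) K, (∀ i, (g i).IsHomogeneous (d i)) →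
      ∀ k, (multiplesFamily d g t Z k).IsHomogeneous t := by
    rintro g hg (x | ζ)
    · have := (isHomogeneous_monomial (d := x.1.2) (1 : K) rfl).mul (hg x.1.1)
      rwa [← expDeg_eq_degree, x.2] at this
    · exact isHomogeneous_monomial _ (hZ _ ζ.2)
  obtain ⟨κ', a, -, hsp, hli⟩ := exists_linearIndependent' K (multiplesFamily d f' t Z)
  have hli2 := linearIndependent_coeff (fun k => hhom f' hf' (a k)) hli
  have : Finite κ' := hli2.finite
  have := Fintype.ofFinite κ'
  let U : ∀ i : ι, (Fin n →₀ ℕ) →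
      MvPolynomial (Σ i : ι, { μ : Fin n →₀ ℕ // expDeg μ = d i }) F :=
    fun i μ => if h : expDeg μ = d i then X ⟨i, μ, h⟩ else 0
  have hU : ∀ g : ι → MvPolynomial (Fin n) K, (∀ i, (g i).IsHomogeneous (d i)) → ∀ i μ,
      aeval (fun p : Σ i : ι, { μ : Fin n →₀ ℕ // expDeg μ = d i } => (g p.1).coeff p.2.1)
        (U i μ) = coeff μ (g i) := by
    intro g hg i μ
    simp only [U]
    split_ifs with h
    · rw [aeval_X]
    · rw [map_zero, (hg i).coeff_eq_zero h]
  let M : { x : ι × (Fin n →₀ ℕ) // expDeg x.2 + d x.1 = t } ⊕ Z →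
      {μ : Fin n →₀ ℕ // expDeg μ = t} →
      MvPolynomial (Σ i : ι, { μ : Fin n →₀ ℕ // expDeg μ = d i }) F :=
    Sum.elim (fun x b => if x.1.2 ≤ b.1 then U x.1.1 (b.1 - x.1.2) else 0)
      (fun ζ b => if ζ.1 = b.1 then 1 else 0)
  have hM : ∀ g : ι → MvPolynomial (Fin n) K, (∀ i, (g i).IsHomogeneous (d i)) → ∀ k b,
      aeval (fun p : Σ i : ι, { μ : Fin n →₀ ℕ // expDeg μ = d i } => (g p.1).coeff p.2.1)
        (M k b) = coeff b.1 (multiplesFamily d g t Z k) := by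
    rintro g hg (x | ζ) b
    · simp only [M, multiplesFamily, Sum.elim_inl]
      rw [coeff_monomial_mul']
      split_ifs with h
      · rw [hU g hg, one_mul]
      · rw [map_zero]
    · simp only [M, multiplesFamily, Sum.elim_inr]
      rw [coeff_monomial]
      split_ifs with h
      · rw [map_one]
      · rw [map_zero]
  have hli3 := linearIndependent_aeval_of_algebraicIndependent hf.2
    (fun p : Σ i : ι, { μ : Fin n →₀ ℕ // expDeg μ = d i } => (f' p.1).coeff p.2.1)
    (fun k => M (a k)) (by simpa only [hM f' hf'] using hli2)
  simp only [hM f hf.1] at hli3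
  have hli4 : LinearIndependent K (multiplesFamily d f t Z ∘ a) := by
    let φ : MvPolynomial (Fin n) K →ₗ[K] ({μ : Fin n →₀ ℕ // expDeg μ = t} → K) :=
      LinearMap.pi fun b => lcoeff K b.1
    exact LinearIndependent.of_comp φ hli3
  rw [← hsp, finrank_span_eq_card hli, ← finrank_span_eq_card hli4]
  have hfin : Module.Finite K (Submodule.span K (Set.range (multiplesFamily d f t Z))) := by
    refine Submodule.finiteDimensional_of_le (S₂ := homogeneousSubmodule (Fin n) K t) ?_
    rw [Submodule.span_le]
    rintro _ ⟨k, rfl⟩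
    exact hhom f hf.1 k
  exact Submodule.finrank_mono (Submodule.span_mono (Set.range_comp_subset_range _ _))

/-- If some forms of the given degrees generate everything in degree `t` modulo a set of monomials,
then so do generic forms. -/
theorem homogeneousSubmodule_le_of_generic {F K ι : Type*} [Field F] [Field K] [Algebra F K]
    [Fintype ι] {n : ℕ} {d : ι → ℕ} {f f' : ι → MvPolynomial (Fin n) K}
    (hf : IsGenericFamily F d f) (hf' : ∀ i, (f' i).IsHomogeneous (d i)) (t : ℕ)
    (Z : Set (Fin n →₀ ℕ)) (hZ : ∀ ζ ∈ Z, expDeg ζ = t)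
    (h : homogeneousSubmodule (Fin n) K t ≤ homPart (Ideal.span (Set.range f')) t ⊔
        Submodule.span K ((fun μ => monomial μ (1 : K)) '' Z)) :
    homogeneousSubmodule (Fin n) K t ≤ homPart (Ideal.span (Set.range f)) t ⊔
        Submodule.span K ((fun μ => monomial μ (1 : K)) '' Z) := by
  have hle : ∀ g : ι → MvPolynomial (Fin n) K,
      homPart (Ideal.span (Set.range g)) t ⊔
        Submodule.span K ((fun μ => monomial μ (1 : K)) '' Z) ≤
          homogeneousSubmodule (Fin n) K t := by
    intro g
    refine sup_le (homPart_le _ _) ?_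
    rw [Submodule.span_le]
    rintro _ ⟨ζ, hζ, rfl⟩
    exact isHomogeneous_monomial _ (hZ ζ hζ)
  have h1 := finrank_homPart_sup_le_of_generic hf hf' t Z hZ
  rw [le_antisymm (hle f') h] at h1
  exact (Submodule.eq_of_le_of_finrank_le (hle f) h1).ge

theorem finrank_span_monomial_image {σ K : Type*} [Field K] {A : Set (σ →₀ ℕ)} (hA : A.Finite) :
    Module.finrank K (Submodule.span K ((fun μ => monomial μ (1 : K)) '' A)) = A.ncard := by
  have := hA.fintype
  have hli : LinearIndependent K (fun μ : A => monomial μ.1 (1 : K)) := by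
    have := (basisMonomials σ K).linearIndependent.comp (fun μ : A => μ.1) Subtype.val_injective
    simpa [Function.comp_def, coe_basisMonomials] using this
  have hr : (fun μ => monomial μ (1 : K)) '' A = Set.range (fun μ : A => monomial μ.1 (1 : K)) := by
    ext p
    simp
  rw [hr, finrank_span_eq_card hli, ← Nat.card_coe_set_eq, Nat.card_eq_fintype_card]

theorem finrank_homogeneousSubmodule (n : ℕ) (K : Type*) [Field K] (t : ℕ) :
    Module.finrank K (homogeneousSubmodule (Fin n) K t) =
      {μ : Fin n →₀ ℕ | expDeg μ = t}.ncard := by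
  rw [homogeneousSubmodule_eq_span_monomial,
    finrank_span_monomial_image (finite_setOf_expDeg_eq n t)]

theorem homPart_span_monomial {n : ℕ} {K : Type*} [CommRing K] (S : Set (Fin n →₀ ℕ)) (t : ℕ) :
    homPart (Ideal.span ((fun μ => monomial μ (1 : K)) '' S)) t =
      Submodule.span K ((fun μ => monomial μ (1 : K)) '' {μ | expDeg μ = t ∧ ∃ ν ∈ S, ν ≤ μ}) := by
  apply le_antisymm
  · rintro p ⟨hp, hpt⟩
    have hp' := mem_ideal_span_monomial_image.mp hp
    rw [p.as_sum]
    refine Submodule.sum_mem _ fun μ hμ => ?_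
    have : monomial μ (coeff μ p) = coeff μ p • monomial μ (1 : K) := by
      rw [smul_monomial, smul_eq_mul, mul_one]
    rw [this]
    exact Submodule.smul_mem _ _
      (Submodule.subset_span ⟨μ, ⟨expDeg_eq_of_mem_support hpt hμ, hp' μ hμ⟩, rfl⟩)
  · rw [Submodule.span_le]
    rintro _ ⟨μ, ⟨hμ, ν, hν, hle⟩, rfl⟩
    refine mem_homPart.mpr ⟨?_, isHomogeneous_monomial _ hμ⟩
    have : monomial μ (1 : K) = monomial (μ - ν) 1 * monomial ν 1 := by
      rw [monomial_mul, tsub_add_cancel_of_le hle, one_mul]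
    simp only [this]
    exact Ideal.mul_mem_left _ _ (Ideal.subset_span ⟨ν, hν, rfl⟩)

theorem homPart_sup_span_singleton_of_lt {σ K : Type*} [CommRing K]
    {I : Ideal (MvPolynomial σ K)} (hI : HasComponents I) {q : MvPolynomial σ K} {e : ℕ}
    (hq : q.IsHomogeneous e) {t : ℕ} (ht : t < e) :
    homPart (I ⊔ Ideal.span {q}) t = homPart I t := by
  refine le_antisymm (fun p hp => ?_) (homPart_mono le_sup_left t)
  obtain h | ⟨s, hs, -⟩ := exists_of_mem_sup_span_singleton hI hq hp.2 hp.1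
  · exact ⟨h, hp.2⟩
  · omega

/-- If two homogeneous ideals have the same Hilbert function, a form that is regular modulo one of
them forces the corresponding form for the other to be regular as soon as the latter generates at
least as much. -/
theorem regular_of_finrank_homPart_le {σ K : Type*} [Finite σ] [Field K]
    {I I' : Ideal (MvPolynomial σ K)} (hI : HasComponents I) (hI' : HasComponents I')
    (hdim : ∀ t, Module.finrank K (homPart I t) = Module.finrank K (homPart I' t))
    {q q' : MvPolynomial σ K} {e : ℕ} (hq : q.IsHomogeneous e) (hq' : q'.IsHomogeneous e)
    (hreg : ∀ p, q' * p ∈ I' → p ∈ I')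
    (hle : ∀ t, Module.finrank K (homPart (I' ⊔ Ideal.span {q'}) t) ≤
      Module.finrank K (homPart (I ⊔ Ideal.span {q}) t)) :
    (∀ t, Module.finrank K (homPart (I ⊔ Ideal.span {q}) t) =
      Module.finrank K (homPart (I' ⊔ Ideal.span {q'}) t)) ∧
    ∀ s, colonPart I q s = homPart I s := by
  have hcol : ∀ s, colonPart I' q' s = homPart I' s := fun s =>
    le_antisymm (fun p hp => ⟨hreg p hp.1, hp.2⟩) (homPart_le_colonPart I' q' s)
  have key : ∀ s, Module.finrank K (homPart (I ⊔ Ideal.span {q}) (s + e)) =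
      Module.finrank K (homPart (I' ⊔ Ideal.span {q'}) (s + e)) ∧
      Module.finrank K (colonPart I q s) ≤ Module.finrank K (homPart I s) := by
    intro s
    have h1 := finrank_homPart_sup_span_singleton hI hq s
    have h2 := finrank_homPart_sup_span_singleton hI' hq' s
    have h3 := Submodule.finrank_mono (homPart_le_colonPart I q s)
    have h4 := hle (s + e)
    rw [hcol] at h2
    have h5 := hdim s
    have h6 := hdim (s + e)
    omega
  refine ⟨fun t => ?_, fun s => ?_⟩
  · rcases lt_or_ge t e with ht | ht
    · rw [homPart_sup_span_singleton_of_lt hI hq ht, homPart_sup_span_singleton_of_lt hI' hq' ht,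
        hdim]
    · obtain ⟨s, rfl⟩ := Nat.exists_eq_add_of_le' ht
      exact (key s).1
  · exact (Submodule.eq_of_le_of_finrank_le (homPart_le_colonPart I q s) (key s).2).symm

theorem mem_span_monomial_of_X_pow_mul_mem {n : ℕ} {K : Type*} [CommRing K] (e : Fin n → ℕ)
    (s : Set (Fin n)) {r : Fin n} (hr : r ∉ s) {k : ℕ} {p : MvPolynomial (Fin n) K}
    (h : X r ^ k * p ∈ Ideal.span
      ((fun μ => monomial μ (1 : K)) '' ((fun j => Finsupp.single j (e j)) '' s))) :
    p ∈ Ideal.span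
      ((fun μ => monomial μ (1 : K)) '' ((fun j => Finsupp.single j (e j)) '' s)) := by
  rw [mem_ideal_span_monomial_image] at h ⊢
  intro μ hμ
  have h1 : Finsupp.single r k + μ ∈ (X r ^ k * p).support := by
    rw [mem_support_iff, X_pow_eq_monomial, coeff_monomial_mul, one_mul]
    exact mem_support_iff.mp hμ
  obtain ⟨_, ⟨j, hj, rfl⟩, hle⟩ := h _ h1
  refine ⟨_, ⟨j, hj, rfl⟩, ?_⟩
  have hjr : r ≠ j := fun h => hr (h ▸ hj)
  rw [Finsupp.single_le_iff] at hle ⊢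
  simpa [Finsupp.single_apply, hjr] using hle

/-- The ideal generated by the first `r` members of a finite sequence. -/
def initialSegmentIdeal {P : Type*} [CommRing P] {N : ℕ} (g : Fin N → P) (r : ℕ) : Ideal P :=
  Ideal.span (Set.range fun j : {j : Fin N // j.val < r} => g j)

theorem initialSegmentIdeal_eq_span_image {P : Type*} [CommRing P] {N : ℕ} (g : Fin N → P)
    (r : ℕ) : initialSegmentIdeal g r = Ideal.span (g '' {j | j.val < r}) := by
  rw [initialSegmentIdeal]
  congr 1
  ext p
  simp

theorem initialSegmentIdeal_succ {P : Type*} [CommRing P] {N : ℕ} (g : Fin N → P) (r : Fin N) :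
    initialSegmentIdeal g (r.val + 1) = initialSegmentIdeal g r.val ⊔ Ideal.span {g r} := by
  rw [initialSegmentIdeal_eq_span_image, initialSegmentIdeal_eq_span_image, ← Ideal.span_union,
    ← Set.image_singleton, ← Set.image_union]
  congr 2
  ext j
  simp only [Set.mem_ofPred_eq, Set.mem_union, Set.mem_singleton_iff, Fin.ext_iff]
  omega

theorem initialSegmentIdeal_X_pow {N : ℕ} (K : Type*) [CommRing K] (e : Fin N → ℕ) (r : ℕ) :
    initialSegmentIdeal (fun j => (X j : MvPolynomial (Fin N) K) ^ e j) r =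
      Ideal.span ((fun μ => monomial μ (1 : K)) ''
        ((fun j => Finsupp.single j (e j)) '' {j : Fin N | j.val < r})) := by
  rw [initialSegmentIdeal_eq_span_image, Set.image_image]
  simp only [X_pow_eq_monomial]

theorem finrank_homPart_initialSegmentIdeal_le {F K : Type*} [Field F] [Field K] [Algebra F K]
    {N : ℕ} {e : Fin N → ℕ} {f : Fin N → MvPolynomial (Fin N) K} (hf : IsGenericFamily F e f)
    (r t : ℕ) :
    Module.finrank K
        (homPart (initialSegmentIdeal (fun j => (X j : MvPolynomial (Fin N) K) ^ e j) r) t) ≤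
      Module.finrank K (homPart (initialSegmentIdeal f r) t) := by
  have h := finrank_homPart_sup_le_of_generic
    (f := fun j : {j : Fin N // j.val < r} => f j.1)
    (hf.comp (e := fun j : {j : Fin N // j.val < r} => j.1) Subtype.val_injective)
    (f' := fun j : {j : Fin N // j.val < r} => (X j.1 : MvPolynomial (Fin N) K) ^ e j.1)
    (fun j => isHomogeneous_X_pow j.1 (e j.1)) t ∅ (fun ζ hζ => absurd hζ (Set.notMem_empty ζ))
  rw [Set.image_empty, Submodule.span_empty, sup_bot_eq, sup_bot_eq] at h
  exact h

/-- A generic sequence of `N` forms in `N` variables has the Hilbert function of the sequence of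
powers of the variables, and it is regular. -/
theorem generic_hilbert_and_regular {F K : Type*} [Field F] [Field K] [Algebra F K] {N : ℕ}
    {e : Fin N → ℕ} {f : Fin N → MvPolynomial (Fin N) K} (hf : IsGenericFamily F e f) (r : ℕ)
    (hr : r ≤ N) :
    (∀ t, Module.finrank K (homPart (initialSegmentIdeal f r) t) =
      Module.finrank K
        (homPart (initialSegmentIdeal (fun j => (X j : MvPolynomial (Fin N) K) ^ e j) r) t)) ∧
    ∀ k : Fin N, k.val < r → ∀ s, colonPart (initialSegmentIdeal f k) (f k) s =
      homPart (initialSegmentIdeal f k) s := by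
  have hX : ∀ j : Fin N, ((X j : MvPolynomial (Fin N) K) ^ e j).IsHomogeneous (e j) :=
    fun j => isHomogeneous_X_pow j (e j)
  have hcomp : ∀ g : Fin N → MvPolynomial (Fin N) K, (∀ j, (g j).IsHomogeneous (e j)) → ∀ r,
      HasComponents (initialSegmentIdeal g r) := fun g hg r =>
    hasComponents_span_range (d := fun j : {j : Fin N // j.val < r} => e j) fun j => hg j
  induction r with
  | zero =>
    refine ⟨fun t => ?_, fun k hk => absurd hk (Nat.not_lt_zero _)⟩
    have h0 : ∀ g : Fin N → MvPolynomial (Fin N) K, initialSegmentIdeal g 0 = ⊥ := fun g => by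
      rw [initialSegmentIdeal_eq_span_image]
      simp
    rw [h0, h0]
  | succ r ih =>
    obtain ⟨ih1, ih2⟩ := ih (by omega)
    let ρ : Fin N := ⟨r, hr⟩
    have hs1 : initialSegmentIdeal f (r + 1) = initialSegmentIdeal f r ⊔ Ideal.span {f ρ} :=
      initialSegmentIdeal_succ f ρ
    have hs2 : initialSegmentIdeal (fun j => (X j : MvPolynomial (Fin N) K) ^ e j) (r + 1) =
        initialSegmentIdeal (fun j => (X j : MvPolynomial (Fin N) K) ^ e j) r ⊔
          Ideal.span {X ρ ^ e ρ} :=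
      initialSegmentIdeal_succ (fun j => (X j : MvPolynomial (Fin N) K) ^ e j) ρ
    have hreg : ∀ p, X ρ ^ e ρ * p ∈
        initialSegmentIdeal (fun j => (X j : MvPolynomial (Fin N) K) ^ e j) r →
        p ∈ initialSegmentIdeal (fun j => (X j : MvPolynomial (Fin N) K) ^ e j) r := by
      intro p hp
      rw [initialSegmentIdeal_X_pow] at hp ⊢
      exact mem_span_monomial_of_X_pow_mul_mem e {j : Fin N | j.val < r} (by simp [ρ]) hp
    have hmain := regular_of_finrank_homPart_le (hcomp f hf.1 r) (hcomp _ hX r) ih1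
      (hf.1 ρ) (hX ρ) hreg fun t => by
        rw [← hs1, ← hs2]
        exact finrank_homPart_initialSegmentIdeal_le hf (r + 1) t
    refine ⟨fun t => ?_, fun k hk s => ?_⟩
    · have := hmain.1 t
      rwa [← hs1, ← hs2] at this
    · rcases Nat.lt_succ_iff_lt_or_eq.mp hk with h | h
      · exact ih2 k h s
      · obtain rfl : k = ρ := Fin.ext h
        exact hmain.2 s

/-- Exponents of degree `t` below the box with side lengths `e`. -/
theorem ncard_box_symm {N : ℕ} {e : Fin N → ℕ} (he : ∀ i, 1 ≤ e i) {s t : ℕ}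
    (hst : s + t + N = ∑ i, e i) :
    {μ : Fin N →₀ ℕ | expDeg μ = s ∧ ∀ i, μ i < e i}.ncard =
      {μ : Fin N →₀ ℕ | expDeg μ = t ∧ ∀ i, μ i < e i}.ncard := by
  have hsum : ∀ μ : Fin N →₀ ℕ, expDeg μ = ∑ i, μ i := fun μ => Finsupp.degree_eq_sum μ
  let c : (Fin N →₀ ℕ) → (Fin N →₀ ℕ) := fun μ =>
    Finsupp.equivFunOnFinite.symm fun i => e i - 1 - μ i
  have hc : ∀ μ i, c μ i = e i - 1 - μ i := fun μ i => rfl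
  have hcdeg : ∀ μ : Fin N →₀ ℕ, (∀ i, μ i < e i) → expDeg μ + expDeg (c μ) + N = ∑ i, e i := by
    intro μ hμ
    rw [hsum, hsum]
    have h1 : ∑ i, μ i + ∑ i, c μ i + N = ∑ i, μ i + ∑ i, c μ i + ∑ _i : Fin N, 1 := by simp
    rw [h1, ← Finset.sum_add_distrib, ← Finset.sum_add_distrib]
    refine Finset.sum_congr rfl fun i _ => ?_
    rw [hc]
    have := hμ i
    omega
  have hlt : ∀ (μ : Fin N →₀ ℕ) i, c μ i < e i := fun μ i => by
    rw [hc]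
    have := he i
    omega
  refine Set.ncard_congr (fun μ _ => c μ) ?_ ?_ ?_
  · rintro μ ⟨h1, h2⟩
    have := hcdeg μ h2
    exact ⟨by omega, hlt μ⟩
  · rintro μ ν ⟨-, h2⟩ ⟨-, h3⟩ h
    ext i
    have h4 : c μ i = c ν i := by rw [h]
    rw [hc, hc] at h4
    have := h2 i
    have := h3 i
    omega
  · rintro ν ⟨h1, h2⟩
    refine ⟨c ν, ⟨?_, hlt ν⟩, ?_⟩
    · have := hcdeg ν h2
      omega
    · ext i
      rw [hc, hc]
      have := h2 i
      omega

theorem finrank_homPart_span_X_pow {N : ℕ} (K : Type*) [Field K] (e : Fin N → ℕ) (t : ℕ) :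
    Module.finrank K (homPart (Ideal.span
        (Set.range fun j => (X j : MvPolynomial (Fin N) K) ^ e j)) t) +
      {μ : Fin N →₀ ℕ | expDeg μ = t ∧ ∀ i, μ i < e i}.ncard =
      Module.finrank K (homogeneousSubmodule (Fin N) K t) := by
  have h1 : (Set.range fun j => (X j : MvPolynomial (Fin N) K) ^ e j) =
      (fun μ => monomial μ (1 : K)) '' (Set.range fun j => Finsupp.single j (e j)) := by
    rw [← Set.range_comp]
    simp only [X_pow_eq_monomial, Function.comp_def]
  have hfin := finite_setOf_expDeg_eq N t
  rw [h1, homPart_span_monomial, finrank_span_monomial_image (hfin.subset fun μ hμ => hμ.1),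
    finrank_homogeneousSubmodule, ← Set.ncard_union_eq ?_ (hfin.subset fun μ hμ => hμ.1)
      (hfin.subset fun μ hμ => hμ.1)]
  · congr 1
    ext μ
    simp only [Set.mem_range, Set.mem_union, Set.mem_ofPred_eq, exists_exists_eq_and,
      Finsupp.single_le_iff]
    rw [← and_or_left, and_iff_left_iff_imp]
    intro _
    by_cases h : ∀ i, μ i < e i
    · exact Or.inr h
    · push Not at h
      exact Or.inl h
  · rw [Set.disjoint_left]
    rintro μ ⟨-, _, ⟨j, rfl⟩, hj⟩ ⟨-, h⟩
    rw [Finsupp.single_le_iff] at hj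
    exact absurd (h j) (not_lt.mpr hj)

/-- The Hilbert function of a generic complete intersection is symmetric. -/
theorem finrank_homPart_generic_symm {F K : Type*} [Field F] [Field K] [Algebra F K] {N : ℕ}
    {e : Fin N → ℕ} (he : ∀ i, 1 ≤ e i) {f : Fin N → MvPolynomial (Fin N) K}
    (hf : IsGenericFamily F e f) {s t : ℕ} (hst : s + t + N = ∑ i, e i) :
    Module.finrank K (homPart (Ideal.span (Set.range f)) s) +
        Module.finrank K (homogeneousSubmodule (Fin N) K t) =
      Module.finrank K (homPart (Ideal.span (Set.range f)) t) +
        Module.finrank K (homogeneousSubmodule (Fin N) K s) := by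
  have hfull : ∀ g : Fin N → MvPolynomial (Fin N) K,
      initialSegmentIdeal g N = Ideal.span (Set.range g) := fun g => by
    rw [initialSegmentIdeal_eq_span_image, ← Set.image_univ]
    congr 2
    ext j
    simp
  have h1 : ∀ t, Module.finrank K (homPart (Ideal.span (Set.range f)) t) =
      Module.finrank K (homPart (Ideal.span
        (Set.range fun j => (X j : MvPolynomial (Fin N) K) ^ e j)) t) := fun t => by
    rw [← hfull, ← hfull]
    exact (generic_hilbert_and_regular hf N le_rfl).1 t
  have h2 := finrank_homPart_span_X_pow K e s
  have h3 := finrank_homPart_span_X_pow K e t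
  have h4 := ncard_box_symm he hst
  rw [h1, h1]
  omega

theorem embExp_castSucc {n : ℕ} (μ : Fin n →₀ ℕ) (i : Fin n) : embExp μ i.castSucc = μ i :=
  Finsupp.embDomain_apply_self (⟨Fin.castSucc, Fin.castSucc_injective n⟩ : Fin n ↪ Fin (n + 1)) μ i

theorem embExp_last {n : ℕ} (μ : Fin n →₀ ℕ) : embExp μ (Fin.last n) = 0 := by
  refine Finsupp.embDomain_of_notMem_range _ _ _ ?_
  rintro ⟨i, hi⟩
  exact (Fin.castSucc_lt_last i).ne hi

theorem embExp_injective {n : ℕ} : Function.Injective (embExp (n := n)) := by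
  intro μ ν h
  ext i
  rw [← embExp_castSucc, h, embExp_castSucc]

theorem expDeg_eq_sum {n : ℕ} (μ : Fin n →₀ ℕ) : expDeg μ = ∑ i, μ i := Finsupp.degree_eq_sum μ

theorem expDeg_embExp {n : ℕ} (μ : Fin n →₀ ℕ) : expDeg (embExp μ) = expDeg μ := by
  rw [expDeg_eq_sum, expDeg_eq_sum, Fin.sum_univ_castSucc, embExp_last, add_zero]
  simp_rw [embExp_castSucc]

/-- Forget the last exponent. -/
noncomputable def restrictExp {n : ℕ} (μ : Fin (n + 1) →₀ ℕ) : Fin n →₀ ℕ :=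
  Finsupp.equivFunOnFinite.symm fun i => μ i.castSucc

theorem restrictExp_apply {n : ℕ} (μ : Fin (n + 1) →₀ ℕ) (i : Fin n) :
    restrictExp μ i = μ i.castSucc := rfl

theorem zShift_castSucc {n : ℕ} (c : ℕ) (μ : Fin (n + 1) →₀ ℕ) (i : Fin n) :
    zShift c μ i.castSucc = μ i.castSucc := by
  simp [zShift]

theorem zShift_last {n : ℕ} (c : ℕ) (μ : Fin (n + 1) →₀ ℕ) :
    zShift c μ (Fin.last n) = μ (Fin.last n) + c := by
  simp [zShift]

theorem finsupp_ext_castSucc {n : ℕ} {μ ν : Fin (n + 1) →₀ ℕ}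
    (h : ∀ i : Fin n, μ i.castSucc = ν i.castSucc) (hl : μ (Fin.last n) = ν (Fin.last n)) :
    μ = ν := by
  ext i
  exact Fin.lastCases hl h i

theorem zShift_embExp_restrictExp {n : ℕ} (μ : Fin (n + 1) →₀ ℕ) :
    zShift (μ (Fin.last n)) (embExp (restrictExp μ)) = μ := by
  refine finsupp_ext_castSucc (fun i => ?_) ?_
  · rw [zShift_castSucc, embExp_castSucc, restrictExp_apply]
  · rw [zShift_last, embExp_last, zero_add]

theorem expDeg_zShift {n : ℕ} (c : ℕ) (μ : Fin (n + 1) →₀ ℕ) :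
    expDeg (zShift c μ) = expDeg μ + c := by
  rw [zShift, expDeg_add, expDeg_single]

theorem monomial_embExp {n : ℕ} {K : Type*} [CommRing K] (μ : Fin n →₀ ℕ) (a : K) :
    monomial (embExp μ) a = rename Fin.castSucc (monomial μ a) := by
  rw [rename_monomial, embExp, Finsupp.embDomain_eq_mapDomain]
  rfl

theorem monomial_zShift {n : ℕ} {K : Type*} [CommRing K] (c : ℕ) (μ : Fin (n + 1) →₀ ℕ) (a : K) :
    monomial (zShift c μ) a = X (Fin.last n) ^ c * monomial μ a := by
  rw [zShift, add_comm μ, X_pow_eq_monomial, monomial_mul, one_mul]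

theorem projMap_X_last (K : Type*) [CommRing K] (n : ℕ) :
    projMap K n (X (Fin.last n)) = 0 := by
  simp [projMap]

theorem projMap_rename {K : Type*} [CommRing K] {n : ℕ} (p : MvPolynomial (Fin n) K) :
    projMap K n (rename Fin.castSucc p) = p := by
  rw [projMap, aeval_rename]
  have : (fun i => Fin.lastCases 0 (fun j => X j) i : Fin (n + 1) → MvPolynomial (Fin n) K) ∘
      Fin.castSucc = X := by
    funext i
    simp
  rw [this, aeval_X_left, AlgHom.id_apply]

theorem coeff_projMap {K : Type*} [CommRing K] {n : ℕ} (p : MvPolynomial (Fin (n + 1)) K)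
    (μ : Fin n →₀ ℕ) : coeff μ (projMap K n p) = coeff (embExp μ) p := by
  classical
  induction p using MvPolynomial.induction_on' with
  | add p q hp hq => rw [map_add, coeff_add, coeff_add, hp, hq]
  | monomial ν a =>
    rw [coeff_monomial]
    conv_lhs => rw [← zShift_embExp_restrictExp ν]
    rw [monomial_zShift, map_mul, map_pow, projMap_X_last, monomial_embExp, projMap_rename]
    by_cases h0 : ν (Fin.last n) = 0
    · rw [h0, pow_zero, one_mul, coeff_monomial]
      congr 1
      rw [eq_iff_iff]
      constructor
      · rintro rfl
        refine finsupp_ext_castSucc (fun i => ?_) ?_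
        · rw [embExp_castSucc, restrictExp_apply]
        · rw [h0, embExp_last]
      · rintro rfl
        ext i
        rw [restrictExp_apply, embExp_castSucc]
    · rw [zero_pow h0, zero_mul, coeff_zero, if_neg]
      rintro rfl
      exact h0 (embExp_last μ)

theorem isHomogeneous_projMap {K : Type*} [CommRing K] {n t : ℕ}
    {p : MvPolynomial (Fin (n + 1)) K} (hp : p.IsHomogeneous t) :
    (projMap K n p).IsHomogeneous t := by
  intro μ hμ
  rw [coeff_projMap] at hμ
  have h : expDeg (embExp μ) = t := expDeg_eq_of_mem_support hp (mem_support_iff.mpr hμ)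
  rw [expDeg_embExp] at h
  rw [← h, expDeg_eq_degree, Finsupp.degree_eq_weight_one]
  rfl

theorem IsGenericFamily.projMap {F K ι : Type*} [CommRing F] [CommRing K] [Algebra F K]
    {n : ℕ} {d : ι → ℕ} {f : ι → MvPolynomial (Fin (n + 1)) K} (h : IsGenericFamily F d f) :
    IsGenericFamily F d (fun i => projMap K n (f i)) := by
  refine ⟨fun i => isHomogeneous_projMap (h.1 i), ?_⟩
  simp only [coeff_projMap]
  refine h.2.comp (fun p : Σ i : ι, { μ : Fin n →₀ ℕ // expDeg μ = d i } =>
    (⟨p.1, embExp p.2.1, by rw [expDeg_embExp, p.2.2]⟩ :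
      Σ i : ι, { μ : Fin (n + 1) →₀ ℕ // expDeg μ = d i })) ?_
  rintro ⟨i, μ, hμ⟩ ⟨j, ν, hν⟩ hij
  obtain rfl : i = j := congrArg Sigma.fst hij
  have h2 : embExp μ = embExp ν := by simpa using hij
  obtain rfl := embExp_injective h2
  rfl

/-- A nonsingular linear system over a field has only the trivial solution in any module. -/
theorem eq_zero_of_linearIndependent_rows {K κ V : Type*} [Field K] [Fintype κ]
    [AddCommGroup V] [Module K V] (T : κ → κ → K) (hT : LinearIndependent K T) (x : κ → V)
    (h : ∀ i, ∑ j, T i j • x j = 0) (l : κ) : x l = 0 := by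
  classical
  have hu : IsUnit (Matrix.of T) := Matrix.linearIndependent_rows_iff_isUnit.mp hT
  have hinv : (Matrix.of T)⁻¹ * Matrix.of T = 1 :=
    Matrix.nonsing_inv_mul _ ((Matrix.isUnit_iff_isUnit_det _).mp hu)
  have h1 : ∑ i, (Matrix.of T)⁻¹ l i • ∑ j, T i j • x j = x l := by
    simp_rw [Finset.smul_sum, smul_smul]
    rw [Finset.sum_comm]
    simp_rw [← Finset.sum_smul]
    have h2 : ∀ j, ∑ i, (Matrix.of T)⁻¹ l i * T i j = if l = j then 1 else 0 := fun j => by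
      have := congrFun (congrFun hinv l) j
      rwa [Matrix.mul_apply, Matrix.one_apply] at this
    simp_rw [h2]
    simp
  rw [← h1]
  simp [h]

/-- A generic binary form of degree `D`, together with `a ^ m` and `z ^ k`, generates all binary
monomials of degree `u` as soon as `m + k + D ≤ 2 * u + 2`. -/
theorem binary_monomial_mem {F K P : Type*} [Field F] [Field K] [Algebra F K] [CommRing P]
    [Algebra K P] (a z : P) {D m k u : ℕ} {c : Fin (D + 1) → K} (hc : AlgebraicIndependent F c)
    (Q : Ideal P) (ha : a ^ m ∈ Q) (hz : z ^ k ∈ Q)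
    (hg : ∑ j : Fin (D + 1), c j • (a ^ j.val * z ^ (D - j.val)) ∈ Q)
    (hu : m + k + D ≤ 2 * u + 2) {i j : ℕ} (hij : i + j = u) : a ^ i * z ^ j ∈ Q := by
  classical
  let x : ℕ → P ⧸ Q := fun i => Ideal.Quotient.mk Q (a ^ i * z ^ (u - i))
  have hx1 : ∀ i, m ≤ i → x i = 0 := fun i hi => Ideal.Quotient.eq_zero_iff_mem.mpr
    (Q.mul_mem_right _ (Q.pow_mem_of_pow_mem ha hi))
  have hx2 : ∀ i, k ≤ u - i → x i = 0 := fun i hi => Ideal.Quotient.eq_zero_iff_mem.mpr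
    (Q.mul_mem_left _ (Q.pow_mem_of_pow_mem hz hi))
  let κ := {i : Fin (u + 1) // i.val < m ∧ u - i.val < k}
  obtain ⟨a0, ha0, ha0'⟩ : ∃ a0, a0 ≤ D ∧ ∀ i : κ, a0 ≤ i.1.val ∧ D ≤ u - i.1.val + a0 := by
    refine ⟨min D (u + 1 - k), min_le_left _ _, fun i => ?_⟩
    obtain ⟨⟨i, hi⟩, h1, h2⟩ := i
    simp only at h1 h2 ⊢
    omega
  let M : κ → κ → MvPolynomial (Fin (D + 1)) F := fun i i' =>
    if h : i.1.val ≤ i'.1.val + a0 ∧ i'.1.val + a0 - i.1.val < D + 1 then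
      X ⟨i'.1.val + a0 - i.1.val, h.2⟩ else 0
  have hM : ∀ (y : Fin (D + 1) → K) i i', aeval y (M i i') =
      if h : i.1.val ≤ i'.1.val + a0 ∧ i'.1.val + a0 - i.1.val < D + 1 then
        y ⟨i'.1.val + a0 - i.1.val, h.2⟩ else 0 := by
    intro y i i'
    simp only [M]
    split_ifs
    · rw [aeval_X]
    · rw [map_zero]
  have hspec : LinearIndependent K fun i i' =>
      aeval (fun j : Fin (D + 1) => if j.val = a0 then (1 : K) else 0) (M i i') := by
    have h1 : (fun i i' => aeval (fun j : Fin (D + 1) => if j.val = a0 then (1 : K) else 0)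
        (M i i')) = (1 : Matrix κ κ K) := by
      funext i i'
      rw [hM, Matrix.one_apply]
      by_cases h : i = i'
      · subst h
        rw [dif_pos ⟨by omega, by omega⟩]
        simp
      · have h' : i.1.val ≠ i'.1.val := fun hv => h (Subtype.ext (Fin.ext hv))
        rw [if_neg h]
        split_ifs with h2 h3
        · simp only at h3
          omega
        · rfl
        · rfl
    rw [h1]
    exact Matrix.linearIndependent_rows_iff_isUnit.mpr isUnit_one
  have hgen := linearIndependent_aeval_of_algebraicIndependent hc _ M hspec
  let c' : ℕ → K := fun j => if h : j < D + 1 then c ⟨j, h⟩ else 0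
  have hzero : ∀ l : κ, x l.1.val = 0 := by
    refine eq_zero_of_linearIndependent_rows _ hgen (fun l => x l.1.val) fun i => ?_
    obtain ⟨h1, h2⟩ := ha0' i
    have hi := i.1.2
    set i₀ := i.1.val - a0 with hi₀
    have hT : ∀ i' : κ, aeval c (M i i') =
        if i₀ ≤ i'.1.val then c' (i'.1.val - i₀) else 0 := by
      intro i'
      rw [hM]
      simp only [c']
      by_cases h3 : i₀ ≤ i'.1.val
      · have h4 : i'.1.val + a0 - i.1.val = i'.1.val - i₀ := by omega
        simp only [h4, h3, if_true]
        have h5 : i.1.val ≤ i'.1.val + a0 := by omega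
        simp only [h5, true_and]
      · rw [dif_neg (by omega), if_neg h3]
    simp_rw [hT]
    let G : ℕ → P ⧸ Q := fun l => (if i₀ ≤ l then c' (l - i₀) else 0) • x l
    have e1 : ∑ j : κ, (if i₀ ≤ j.1.val then c' (j.1.val - i₀) else 0) • x j.1.val =
        ∑ l ∈ Finset.range (u + 1), G l := by
      rw [Finset.sum_range]
      change ∑ j : κ, G j.1.val = _
      rw [← Finset.sum_subtype (Finset.univ.filter
        fun l : Fin (u + 1) => l.val < m ∧ u - l.val < k) (fun l => by simp)
        (fun l : Fin (u + 1) => G l.val)]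
      refine Finset.sum_filter_of_ne fun l _ hl => ?_
      by_contra hcon
      refine hl ?_
      have hxl : x l.val = 0 := by
        rcases not_and_or.mp hcon with h3 | h3
        · exact hx1 _ (not_lt.mp h3)
        · exact hx2 _ (not_lt.mp h3)
      simp only [G, hxl, smul_zero]
    have e2 : ∑ l ∈ Finset.range (u + 1), G l = ∑ l ∈ Finset.Ico i₀ (i₀ + (D + 1)), G l := by
      symm
      refine Finset.sum_subset (fun l hl => ?_) fun l hl hl' => ?_
      · rw [Finset.mem_Ico] at hl
        rw [Finset.mem_range]
        omega
      · rw [Finset.mem_Ico] at hl'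
        simp only [G, c']
        split_ifs
        · omega
        · rw [zero_smul]
        · rw [zero_smul]
    rw [e1, e2, Finset.sum_Ico_eq_sum_range, Nat.add_sub_cancel_left, Finset.sum_range]
    have e3 : ∀ j : Fin (D + 1), G (i₀ + j.val) = Ideal.Quotient.mkₐ K Q
        (c j • (a ^ j.val * z ^ (D - j.val)) * (a ^ i₀ * z ^ (u - D - i₀))) := by
      intro j
      have hj := j.2
      have h6 : u - (i₀ + j.val) = (D - j.val) + (u - D - i₀) := by omega
      simp only [G, c', x]
      rw [if_pos (Nat.le_add_right _ _), Nat.add_sub_cancel_left, dif_pos hj, smul_mul_assoc,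
        map_smul, h6, show a ^ (i₀ + j.val) * z ^ (D - j.val + (u - D - i₀)) =
          a ^ j.val * z ^ (D - j.val) * (a ^ i₀ * z ^ (u - D - i₀)) by rw [pow_add, pow_add]; ring]
      rfl
    simp_rw [e3]
    rw [← map_sum, ← Finset.sum_mul]
    exact Ideal.Quotient.eq_zero_iff_mem.mpr (Q.mul_mem_right _ hg)
  have hfin : x i = 0 := by
    by_cases h1 : m ≤ i
    · exact hx1 i h1
    by_cases h2 : k ≤ u - i
    · exact hx2 i h2
    exact hzero ⟨⟨i, by omega⟩, by simp only; omega⟩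
  have := Ideal.Quotient.eq_zero_iff_mem.mp hfin
  rwa [show u - i = j by omega] at this

theorem homogeneousSubmodule_le_of_monomial_mem {n t : ℕ} {K : Type*} [CommRing K]
    {V : Submodule K (MvPolynomial (Fin n) K)}
    (h : ∀ μ : Fin n →₀ ℕ, expDeg μ = t → monomial μ (1 : K) ∈ V) :
    homogeneousSubmodule (Fin n) K t ≤ V := by
  rw [homogeneousSubmodule_eq_span_monomial, Submodule.span_le]
  rintro _ ⟨μ, hμ, rfl⟩
  exact h μ hμ

theorem homogeneousSubmodule_le_sup_X_last_pow_iff {n t k : ℕ} {K : Type*} [CommRing K]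
    {I : Ideal (MvPolynomial (Fin (n + 1)) K)} (hI : HasComponents I) :
    homogeneousSubmodule (Fin (n + 1)) K t ≤ homPart I t ⊔
        Submodule.span K ((fun μ => monomial μ (1 : K)) ''
          {μ | expDeg μ = t ∧ k ≤ μ (Fin.last n)}) ↔
      ∀ p : MvPolynomial (Fin (n + 1)) K, p.IsHomogeneous t →
        p ∈ I ⊔ Ideal.span {X (Fin.last n) ^ k} := by
  constructor
  · intro h p hp
    have h1 : homPart I t ⊔ Submodule.span K ((fun μ => monomial μ (1 : K)) ''
        {μ : Fin (n + 1) →₀ ℕ | expDeg μ = t ∧ k ≤ μ (Fin.last n)}) ≤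
        (I ⊔ Ideal.span {X (Fin.last n) ^ k}).restrictScalars K := by
      refine sup_le (fun q hq => Ideal.mem_sup_left hq.1) ?_
      rw [Submodule.span_le]
      rintro _ ⟨μ, ⟨-, hk⟩, rfl⟩
      refine Ideal.mem_sup_right (Ideal.mem_span_singleton.mpr ?_)
      change X (Fin.last n) ^ k ∣ monomial μ (1 : K)
      rw [X_pow_eq_monomial, monomial_dvd_monomial]
      exact ⟨Or.inr (Finsupp.single_le_iff.mpr hk), one_dvd _⟩
    exact h1 (h hp)
  · intro h p hp
    obtain h1 | ⟨s, rfl, r, hr, h1⟩ :=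
      exists_of_mem_sup_span_singleton hI (isHomogeneous_X_pow (Fin.last n) k) hp (h p hp)
    · exact Submodule.mem_sup_left ⟨h1, hp⟩
    · have hmul : (X (Fin.last n) ^ k * r).IsHomogeneous (s + k) := by
        rw [add_comm s]
        exact (isHomogeneous_X_pow (Fin.last n) k).mul hr
      rw [← sub_add_cancel p (X (Fin.last n) ^ k * r)]
      refine Submodule.add_mem_sup ⟨h1, hp.sub hmul⟩ ?_
      have h2 : homogeneousSubmodule (Fin (n + 1)) K s ≤ (Submodule.span K
          ((fun μ => monomial μ (1 : K)) '' {μ : Fin (n + 1) →₀ ℕ | expDeg μ = s + k ∧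
            k ≤ μ (Fin.last n)})).comap (LinearMap.mulLeft K (X (Fin.last n) ^ k)) := by
        refine homogeneousSubmodule_le_of_monomial_mem fun μ hμ => ?_
        rw [Submodule.mem_comap, LinearMap.mulLeft_apply, ← monomial_zShift]
        refine Submodule.subset_span ⟨_, ⟨?_, ?_⟩, rfl⟩
        · rw [expDeg_zShift, hμ]
        · rw [zShift_last]
          exact Nat.le_add_left _ _
      exact h2 hr

theorem mem_sup_X_last_pow_of_special {F K ι : Type*} [Field F] [Field K] [Algebra F K]
    [Fintype ι] {n t k : ℕ} {d : ι → ℕ} {f f' : ι → MvPolynomial (Fin (n + 1)) K}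
    (hf : IsGenericFamily F d f) (hf' : ∀ i, (f' i).IsHomogeneous (d i))
    (h : ∀ p : MvPolynomial (Fin (n + 1)) K, p.IsHomogeneous t →
      p ∈ Ideal.span (Set.range f') ⊔ Ideal.span {X (Fin.last n) ^ k})
    {p : MvPolynomial (Fin (n + 1)) K} (hp : p.IsHomogeneous t) :
    p ∈ Ideal.span (Set.range f) ⊔ Ideal.span {X (Fin.last n) ^ k} := by
  refine (homogeneousSubmodule_le_sup_X_last_pow_iff (hasComponents_span_range hf.1)).mp ?_ p hp
  exact homogeneousSubmodule_le_of_generic hf hf' t _ (fun ζ hζ => hζ.1)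
    ((homogeneousSubmodule_le_sup_X_last_pow_iff (hasComponents_span_range hf')).mpr h)

/-- The inductive step for the surjectivity of multiplication by powers of the last variable:
two variables are added to the forms, and a generic binary form to the ideal. -/
theorem rename_mul_mem_of_binary_form {F K : Type*} [Field F] [Field K] [Algebra F K]
    {n E D k : ℕ} {J : Ideal (MvPolynomial (Fin (n + 1)) K)} (hJ : HasComponents J)
    (hsurj : ∀ t m, E + m ≤ 2 * t + (n + 1) → ∀ p : MvPolynomial (Fin (n + 1)) K,
      p.IsHomogeneous t → p ∈ J ⊔ Ideal.span {X (Fin.last n) ^ m})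
    {c : Fin (D + 1) → K} (hc : AlgebraicIndependent F c)
    {Q : Ideal (MvPolynomial (Fin (n + 2)) K)}
    (hJQ : ∀ p ∈ J, rename Fin.castSucc p ∈ Q) (hz : X (Fin.last (n + 1)) ^ k ∈ Q)
    (hb : ∑ j : Fin (D + 1), c j • ((X (Fin.last n).castSucc : MvPolynomial (Fin (n + 2)) K) ^ j.val *
      X (Fin.last (n + 1)) ^ (D - j.val)) ∈ Q) (s : ℕ) :
    ∀ (q : MvPolynomial (Fin (n + 1)) K), q.IsHomogeneous s → ∀ i j : ℕ,
      E + D + k ≤ 2 * (s + i + j) + (n + 2) →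
      rename Fin.castSucc q * (X (Fin.last n).castSucc ^ i * X (Fin.last (n + 1)) ^ j) ∈ Q := by
  induction s using Nat.strong_induction_on with
  | _ s ih =>
  intro q hq i j hij
  obtain ⟨m, hm⟩ : ∃ m, m = E - n - 2 * s := ⟨_, rfl⟩
  have prim : ∀ q' : MvPolynomial (Fin (n + 1)) K, X (Fin.last n) ^ m * q' ∈ J →
      rename Fin.castSucc q' * (X (Fin.last n).castSucc ^ i * X (Fin.last (n + 1)) ^ j) ∈ Q := by
    intro q' hq'
    rcases Nat.eq_zero_or_pos m with h0 | h0
    · rw [h0, pow_zero, one_mul] at hq'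
      exact Q.mul_mem_right _ (hJQ _ hq')
    · have h1 := hJQ _ hq'
      rw [map_mul, map_pow, rename_X] at h1
      have h2 := binary_monomial_mem (X (Fin.last n).castSucc : MvPolynomial (Fin (n + 2)) K)
        (X (Fin.last (n + 1))) (m := m) (k := k) (u := i + j) hc
        (Q.colon {rename Fin.castSucc q'})
        (by rw [Submodule.mem_colon_singleton, smul_eq_mul]; exact h1)
        (by rw [Submodule.mem_colon_singleton, smul_eq_mul]; exact Q.mul_mem_right _ hz)
        (by rw [Submodule.mem_colon_singleton, smul_eq_mul]; exact Q.mul_mem_right _ hb) (by omega) rfl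
      rw [Submodule.mem_colon_singleton, smul_eq_mul] at h2
      rwa [mul_comm]
  have hmq : (X (Fin.last n) ^ m * q).IsHomogeneous (m + s) :=
    (isHomogeneous_X_pow (Fin.last n) m).mul hq
  obtain h1 | ⟨s', hs', r, hr, h1⟩ := exists_of_mem_sup_span_singleton hJ
    (isHomogeneous_X_pow (Fin.last n) (m + 1)) hmq (hsurj (m + s) (m + 1) (by omega) _ hmq)
  · exact prim q h1
  · have h2 := prim (q - X (Fin.last n) * r) (by
      rw [show X (Fin.last n) ^ m * (q - X (Fin.last n) * r) =
        X (Fin.last n) ^ m * q - X (Fin.last n) ^ (m + 1) * r by ring]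
      exact h1)
    have h3 := ih s' (by omega) r hr (i + 1) j (by omega)
    have h4 := Q.add_mem h2 h3
    rw [map_sub, map_mul, rename_X] at h4
    convert h4 using 1
    ring

/-- Multiplication by a power of the last variable is surjective modulo a generic complete
intersection in the expected range of degrees. -/
theorem mem_sup_X_last_pow_of_generic {F K : Type*} [Field F] [Field K] [Algebra F K] (n : ℕ) :
    ∀ {e : Fin (n + 1) → ℕ} {f : Fin (n + 1) → MvPolynomial (Fin (n + 1)) K},
      IsGenericFamily F e f → ∀ t k, ∑ i, e i + k ≤ 2 * t + (n + 1) →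
      ∀ p : MvPolynomial (Fin (n + 1)) K, p.IsHomogeneous t →
        p ∈ Ideal.span (Set.range f) ⊔ Ideal.span {X (Fin.last n) ^ k} := by
  induction n with
  | zero =>
    intro e f hf t k h p hp
    refine mem_sup_X_last_pow_of_special hf (f' := fun i => X i ^ e i)
      (fun i => isHomogeneous_X_pow i (e i)) (fun q hq => ?_) hp
    refine homogeneousSubmodule_le_of_monomial_mem (V := Submodule.restrictScalars K
      (Ideal.span (Set.range fun i => X i ^ e i) ⊔ Ideal.span {X (Fin.last 0) ^ k})) ?_ hq
    intro μ hμ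
    rw [expDeg_eq_sum, Fin.sum_univ_one] at hμ
    rw [Fin.sum_univ_one] at h
    have h1 : monomial μ (1 : K) = X 0 ^ t := by
      rw [X_pow_eq_monomial]
      congr 2
      ext i
      rw [Fin.fin_one_eq_zero i, Finsupp.single_eq_same, hμ]
    rw [Submodule.restrictScalars_mem, h1]
    by_cases h2 : e 0 ≤ t
    · exact Ideal.mem_sup_left (Ideal.pow_mem_of_pow_mem _ (Ideal.subset_span (Set.mem_range_self 0)) h2)
    · exact Ideal.mem_sup_right
        (Ideal.pow_mem_of_pow_mem _ (Ideal.subset_span rfl) (by omega : k ≤ t))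
  | succ n ih =>
    intro e f hf t k h p hp
    let D := e (Fin.last (n + 1))
    let expo : Fin (D + 1) → (Fin (n + 2) →₀ ℕ) := fun j =>
      Finsupp.single (Fin.last n).castSucc j.val + Finsupp.single (Fin.last (n + 1)) (D - j.val)
    have hexpo : ∀ j, expDeg (expo j) = D := fun j => by
      have := j.2
      rw [expDeg_add, expDeg_single, expDeg_single]
      omega
    let c : Fin (D + 1) → K := fun j => coeff (expo j) (f (Fin.last (n + 1)))
    have hc : AlgebraicIndependent F c := by
      refine hf.2.comp (fun j : Fin (D + 1) => (⟨Fin.last (n + 1), expo j, hexpo j⟩ :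
        Σ i : Fin (n + 2), { μ : Fin (n + 2) →₀ ℕ // expDeg μ = e i })) ?_
      intro j j' hjj
      have h1 : expo j = expo j' := by simpa using hjj
      have h2 := DFunLike.congr_fun h1 (Fin.last n).castSucc
      have h3 : Fin.last (n + 1) ≠ (Fin.last n).castSucc := (Fin.castSucc_lt_last _).ne'
      simp [expo] at h2
      exact Fin.ext h2
    let fb : Fin (n + 1) → MvPolynomial (Fin (n + 1)) K := fun i => projMap K (n + 1) (f i.castSucc)
    have hfb : IsGenericFamily F (fun i : Fin (n + 1) => e i.castSucc) fb :=
      (hf.comp (Fin.castSucc_injective (n + 1))).projMap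
    let b : MvPolynomial (Fin (n + 2)) K := ∑ j : Fin (D + 1),
      c j • (X (Fin.last n).castSucc ^ j.val * X (Fin.last (n + 1)) ^ (D - j.val))
    have hb : b.IsHomogeneous D := by
      refine IsHomogeneous.sum _ _ _ fun j _ => ?_
      refine (homogeneousSubmodule _ _ _).smul_mem _ ?_
      have h1 := (isHomogeneous_X_pow (R := K) (Fin.last n).castSucc j.val).mul
        (isHomogeneous_X_pow (R := K) (Fin.last (n + 1)) (D - j.val))
      have := j.2
      rwa [show j.val + (D - j.val) = D by omega] at h1
    let f' : Fin (n + 2) → MvPolynomial (Fin (n + 2)) K :=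
      Fin.snoc (fun i => rename Fin.castSucc (fb i)) b
    have hf' : ∀ i, (f' i).IsHomogeneous (e i) := by
      intro i
      refine Fin.lastCases ?_ (fun i => ?_) i
      · simpa [f'] using hb
      · simpa [f'] using (hfb.1 i).rename_isHomogeneous (f := Fin.castSucc)
    refine mem_sup_X_last_pow_of_special hf hf' (fun q hq => ?_) hp
    refine homogeneousSubmodule_le_of_monomial_mem (V := Submodule.restrictScalars K
      (Ideal.span (Set.range f') ⊔ Ideal.span {X (Fin.last (n + 1)) ^ k})) ?_ hq
    intro μ hμ
    have hJQ : Ideal.span (Set.range fb) ≤ (Ideal.span (Set.range f') ⊔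
        Ideal.span {X (Fin.last (n + 1)) ^ k}).comap (rename Fin.castSucc) := by
      rw [Ideal.span_le]
      rintro _ ⟨i, rfl⟩
      refine Ideal.mem_sup_left (Ideal.subset_span ⟨i.castSucc, ?_⟩)
      simp [f']
    rw [Fin.sum_univ_castSucc] at h
    have hbmem : b ∈ Ideal.span (Set.range f') :=
      Ideal.subset_span ⟨Fin.last (n + 1), by simp only [f', Fin.snoc_last]⟩
    have hbmem' : b ∈ Ideal.span (Set.range f') ⊔ Ideal.span {X (Fin.last (n + 1)) ^ k} :=
      Ideal.mem_sup_left hbmem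
    have hzmem : X (Fin.last (n + 1)) ^ k ∈
        Ideal.span (Set.range f') ⊔ Ideal.span {X (Fin.last (n + 1)) ^ k} :=
      Ideal.mem_sup_right (Ideal.subset_span rfl)
    have h1 := rename_mul_mem_of_binary_form (k := k) (hasComponents_span_range hfb.1)
      (fun t m => ih hfb t m) hc (fun q hq => hJQ hq) hzmem hbmem'
      (expDeg (restrictExp μ)) (monomial (restrictExp μ) 1) (isHomogeneous_monomial _ rfl) 0
      (μ (Fin.last (n + 1))) (by
        have h2 : expDeg (restrictExp μ) + μ (Fin.last (n + 1)) = t := by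
          rw [← expDeg_embExp, ← expDeg_zShift, zShift_embExp_restrictExp, hμ]
        change _ + e (Fin.last (n + 1)) + k ≤ _
        omega)
    rw [pow_zero, one_mul, mul_comm, ← monomial_embExp, ← monomial_zShift,
      zShift_embExp_restrictExp] at h1
    exact h1

/-- Multiplication by a power of the last variable is injective modulo a generic complete
intersection in the expected range of degrees. -/
theorem mem_of_X_last_pow_mul_mem {F K : Type*} [Field F] [Field K] [Algebra F K] {n : ℕ}
    {e : Fin (n + 1) → ℕ} (he : ∀ i, 1 ≤ e i)
    {f : Fin (n + 1) → MvPolynomial (Fin (n + 1)) K} (hf : IsGenericFamily F e f) {s k : ℕ}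
    (hsk : 2 * s + k + (n + 1) ≤ ∑ i, e i) {p : MvPolynomial (Fin (n + 1)) K}
    (hp : p.IsHomogeneous s) (h : X (Fin.last n) ^ k * p ∈ Ideal.span (Set.range f)) :
    p ∈ Ideal.span (Set.range f) := by
  obtain ⟨m, hm⟩ : ∃ m, 2 * s + m + (n + 1) = ∑ i, e i :=
    ⟨∑ i, e i - (n + 1) - 2 * s, by omega⟩
  have hI := hasComponents_span_range hf.1
  have h1 := finrank_homPart_sup_span_singleton hI (isHomogeneous_X_pow (Fin.last n) m) s
  have h2 : homPart (Ideal.span (Set.range f) ⊔ Ideal.span {X (Fin.last n) ^ m}) (s + m) =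
      homogeneousSubmodule (Fin (n + 1)) K (s + m) :=
    le_antisymm (homPart_le _ _) fun q hq =>
      ⟨mem_sup_X_last_pow_of_generic n hf (s + m) m (by omega) q hq, hq⟩
  have h3 := finrank_homPart_generic_symm he hf (s := s) (t := s + m) (by omega)
  rw [h2] at h1
  have h4 : homPart (Ideal.span (Set.range f)) s =
      colonPart (Ideal.span (Set.range f)) (X (Fin.last n) ^ m) s :=
    Submodule.eq_of_le_of_finrank_eq (homPart_le_colonPart _ _ s) (by omega)
  have h5 : p ∈ colonPart (Ideal.span (Set.range f)) (X (Fin.last n) ^ m) s := by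
    refine mem_colonPart.mpr ⟨?_, hp⟩
    rw [show m = (m - k) + k by omega, pow_add, mul_assoc]
    exact Ideal.mul_mem_left _ _ h
  rw [← h4] at h5
  exact h5.1

theorem DrlLT.irrefl {n : ℕ} (a : Fin n →₀ ℕ) : ¬ DrlLT a a := by
  rintro (h | ⟨-, i, h, -⟩)
  · exact lt_irrefl _ h
  · exact lt_irrefl _ h

theorem DrlLT.trans {n : ℕ} {a b c : Fin n →₀ ℕ} (hab : DrlLT a b) (hbc : DrlLT b c) :
    DrlLT a c := by
  rcases hab with hab | ⟨hab, i, hi, hi'⟩ <;> rcases hbc with hbc | ⟨hbc, j, hj, hj'⟩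
  · exact Or.inl (hab.trans hbc)
  · exact Or.inl (hbc ▸ hab)
  · exact Or.inl (hab ▸ hbc)
  · refine Or.inr ⟨hab.trans hbc, ?_⟩
    rcases lt_trichotomy i j with hij | rfl | hij
    · exact ⟨j, by rw [hi' j hij]; exact hj,
        fun l hl => (hi' l (hij.trans hl)).trans (hj' l hl)⟩
    · exact ⟨i, hj.trans hi, fun l hl => (hi' l hl).trans (hj' l hl)⟩
    · exact ⟨i, by rw [← hj' i hij]; exact hi,
        fun l hl => (hi' l hl).trans (hj' l (hij.trans hl))⟩

theorem DrlLT.asymm {n : ℕ} {a b : Fin n →₀ ℕ} (h : DrlLT a b) : ¬ DrlLT b a :=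
  fun h' => DrlLT.irrefl a (h.trans h')

theorem drlLT_or_drlLT_of_ne {n : ℕ} {a b : Fin n →₀ ℕ} (h : a ≠ b) : DrlLT a b ∨ DrlLT b a := by
  rcases lt_trichotomy (expDeg a) (expDeg b) with hd | hd | hd
  · exact Or.inl (Or.inl hd)
  · have hne : (Finset.univ.filter fun i => a i ≠ b i).Nonempty := by
      obtain ⟨i, hi⟩ := DFunLike.ne_iff.mp h
      exact ⟨i, by simpa using hi⟩
    obtain ⟨i, hi, hmax⟩ := Finset.exists_maximal hne
    have heq : ∀ j, i < j → a j = b j := fun j hj => by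
      by_contra hcon
      exact (hmax (by simpa using hcon) hj.le).not_gt hj
    have hi' : a i ≠ b i := by simpa using hi
    rcases lt_or_gt_of_ne hi' with hlt | hlt
    · exact Or.inr (Or.inr ⟨hd.symm, i, hlt, fun j hj => (heq j hj).symm⟩)
    · exact Or.inl (Or.inr ⟨hd, i, hlt, heq⟩)
  · exact Or.inr (Or.inl hd)

theorem DrlLT.add_left {n : ℕ} {a b : Fin n →₀ ℕ} (h : DrlLT a b) (c : Fin n →₀ ℕ) :
    DrlLT (c + a) (c + b) := by
  rw [DrlLT, expDeg_add, expDeg_add]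
  rcases h with h | ⟨h, i, hi, hi'⟩
  · exact Or.inl (by omega)
  · refine Or.inr ⟨by omega, i, ?_, fun j hj => ?_⟩
    · rw [Finsupp.add_apply, Finsupp.add_apply]
      omega
    · rw [Finsupp.add_apply, Finsupp.add_apply, hi' j hj]

theorem DrlLT.embExp {n : ℕ} {a b : Fin n →₀ ℕ} (h : DrlLT a b) :
    DrlLT (embExp a) (embExp b) := by
  rw [DrlLT, expDeg_embExp, expDeg_embExp]
  refine h.imp_right fun ⟨h, i, hi, hi'⟩ => ⟨h, i.castSucc, ?_, fun j => ?_⟩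
  · rwa [embExp_castSucc, embExp_castSucc]
  · refine Fin.lastCases (fun _ => ?_) (fun j hj => ?_) j
    · rw [embExp_last, embExp_last]
    · rw [embExp_castSucc, embExp_castSucc, hi' j (Fin.castSucc_lt_castSucc_iff.mp hj)]

theorem drlLT_of_last_lt {n : ℕ} {a b : Fin (n + 1) →₀ ℕ} (hd : expDeg a = expDeg b)
    (h : b (Fin.last n) < a (Fin.last n)) : DrlLT a b :=
  Or.inr ⟨hd, Fin.last n, h, fun j hj => absurd (Fin.le_last j) hj.not_ge⟩

theorem exists_drlLT_max {n : ℕ} (s : Finset (Fin n →₀ ℕ)) (hs : s.Nonempty) :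
    ∃ μ ∈ s, ∀ ν ∈ s, ν ≠ μ → DrlLT ν μ := by
  induction hs using Finset.Nonempty.cons_induction with
  | singleton a => exact ⟨a, Finset.mem_singleton_self a, fun ν hν h =>
      absurd (Finset.mem_singleton.mp hν) h⟩
  | cons a s ha hs ih =>
    obtain ⟨μ, hμ, hmax⟩ := ih
    have hne : a ≠ μ := fun h => ha (h ▸ hμ)
    rcases drlLT_or_drlLT_of_ne hne with h | h
    · refine ⟨μ, Finset.mem_cons_of_mem hμ, fun ν hν hν' => ?_⟩
      rcases Finset.mem_cons.mp hν with rfl | hν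
      · exact h
      · exact hmax ν hν hν'
    · refine ⟨a, Finset.mem_cons_self a s, fun ν hν hν' => ?_⟩
      rcases Finset.mem_cons.mp hν with rfl | hν
      · exact absurd rfl hν'
      · by_cases h' : ν = μ
        · exact h' ▸ h
        · exact (hmax ν hν h').trans h

theorem exists_isLeadExp {n : ℕ} {K : Type*} [CommSemiring K] {p : MvPolynomial (Fin n) K}
    (hp : p ≠ 0) : ∃ μ, IsLeadExp p μ := by
  obtain ⟨μ, hμ, h⟩ := exists_drlLT_max p.support (support_nonempty.mpr hp)
  exact ⟨μ, hμ, h⟩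

theorem IsLeadExp.ne_zero {n : ℕ} {K : Type*} [CommSemiring K] {p : MvPolynomial (Fin n) K}
    {μ : Fin n →₀ ℕ} (h : IsLeadExp p μ) : p ≠ 0 := by
  rintro rfl
  simpa using h.1

theorem IsLeadExp.coeff_eq_zero {n : ℕ} {K : Type*} [CommSemiring K] {p : MvPolynomial (Fin n) K}
    {μ ν : Fin n →₀ ℕ} (h : IsLeadExp p μ) (hν : DrlLT μ ν) : coeff ν p = 0 := by
  by_contra hcon
  have hne : ν ≠ μ := fun h' => DrlLT.irrefl μ (h' ▸ hν)
  exact hν.asymm (h.2 ν (mem_support_iff.mpr hcon) hne)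

theorem IsLeadExp.monomial_mul {n : ℕ} {K : Type*} [CommSemiring K] {p : MvPolynomial (Fin n) K}
    {μ : Fin n →₀ ℕ} (h : IsLeadExp p μ) (ν : Fin n →₀ ℕ) :
    IsLeadExp (monomial ν 1 * p) (ν + μ) := by
  constructor
  · rw [mem_support_iff, coeff_monomial_mul, one_mul]
    exact mem_support_iff.mp h.1
  · intro κ hκ hne
    rw [mem_support_iff, coeff_monomial_mul'] at hκ
    split_ifs at hκ with hle
    · rw [one_mul] at hκ
      have h1 : κ = ν + (κ - ν) := (add_tsub_cancel_of_le hle).symm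
      rw [h1]
      refine (h.2 (κ - ν) (mem_support_iff.mpr hκ) fun h2 => hne ?_).add_left ν
      rw [h1, h2]
    · exact absurd rfl hκ

/-- The leading exponents of the elements of a space of polynomials. -/
def leadExps {n : ℕ} {K : Type*} [CommSemiring K] (V : Submodule K (MvPolynomial (Fin n) K)) :
    Set (Fin n →₀ ℕ) :=
  {μ | ∃ p ∈ V, IsLeadExp p μ}

theorem initialIdeal_eq_span_image {n : ℕ} {K : Type*} [CommRing K]
    (I : Ideal (MvPolynomial (Fin n) K)) :
    initialIdeal I = Ideal.span ((fun μ => monomial μ (1 : K)) ''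
      {μ | ∃ p ∈ I, IsLeadExp p μ}) := by
  rw [initialIdeal]
  congr 1
  ext m
  constructor
  · rintro ⟨p, hp, -, μ, hμ, rfl⟩
    exact ⟨μ, ⟨p, hp, hμ⟩, rfl⟩
  · rintro ⟨μ, ⟨p, hp, hμ⟩, rfl⟩
    exact ⟨p, hp, hμ.ne_zero, μ, hμ, rfl⟩

theorem monomial_mem_initialIdeal_iff {n : ℕ} {K : Type*} [Field K]
    {I : Ideal (MvPolynomial (Fin n) K)} {μ : Fin n →₀ ℕ} :
    monomial μ (1 : K) ∈ initialIdeal I ↔ ∃ p ∈ I, IsLeadExp p μ := by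
  classical
  rw [initialIdeal_eq_span_image]
  constructor
  · intro h
    obtain ⟨ν, ⟨p, hp, hν⟩, hle⟩ := mem_ideal_span_monomial_image.mp h μ
      (mem_support_iff.mpr (by rw [coeff_monomial, if_pos rfl]; exact one_ne_zero))
    refine ⟨monomial (μ - ν) 1 * p, I.mul_mem_left _ hp, ?_⟩
    have h1 := hν.monomial_mul (μ - ν)
    rwa [tsub_add_cancel_of_le hle] at h1
  · intro h
    exact Ideal.subset_span ⟨μ, h, rfl⟩

theorem monomial_mem_initialIdeal_iff_leadExps {n : ℕ} {K : Type*} [Field K]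
    {I : Ideal (MvPolynomial (Fin n) K)} (hI : HasComponents I) {μ : Fin n →₀ ℕ} :
    monomial μ (1 : K) ∈ initialIdeal I ↔ μ ∈ leadExps (homPart I (expDeg μ)) := by
  rw [monomial_mem_initialIdeal_iff]
  constructor
  · rintro ⟨p, hp, hμ⟩
    refine ⟨homogeneousComponent (expDeg μ) p,
      ⟨hI p hp _, homogeneousComponent_isHomogeneous _ p⟩, ?_, fun ν hν => hμ.2 ν ?_⟩
    · rw [mem_support_iff, coeff_homogeneousComponent, expDeg_eq_degree, if_pos rfl]
      exact mem_support_iff.mp hμ.1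
    · rw [mem_support_iff, coeff_homogeneousComponent] at hν
      exact mem_support_iff.mpr (ite_ne_right_iff.mp hν).2
  · rintro ⟨p, hp, hμ⟩
    exact ⟨p, hp.1, hμ⟩

theorem leadExps_subset {n : ℕ} {K : Type*} [CommRing K] {t : ℕ}
    {V : Submodule K (MvPolynomial (Fin n) K)} (hV : V ≤ homogeneousSubmodule (Fin n) K t) :
    leadExps V ⊆ {μ | expDeg μ = t} := by
  rintro μ ⟨p, hp, hμ⟩
  exact expDeg_eq_of_mem_support (hV hp) hμ.1

/-- Macaulay: a space of forms has as many leading exponents as its dimension. -/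
theorem finrank_eq_ncard_leadExps {n : ℕ} {K : Type*} [Field K] {t : ℕ}
    {V : Submodule K (MvPolynomial (Fin n) K)} (hV : V ≤ homogeneousSubmodule (Fin n) K t) :
    Module.finrank K V = (leadExps V).ncard := by
  classical
  have hfin : (leadExps V).Finite := (finite_setOf_expDeg_eq n t).subset (leadExps_subset hV)
  have := hfin.fintype
  have : Module.Finite K V := Submodule.finiteDimensional_of_le hV
  rw [Set.ncard_eq_toFinset_card', Set.toFinset_card]
  apply le_antisymm
  · let φ : V →ₗ[K] (leadExps V → K) := (LinearMap.pi fun μ => lcoeff K μ.1).comp V.subtype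
    have hφ : Function.Injective φ := by
      rw [injective_iff_map_eq_zero]
      intro p hp
      by_contra hne
      obtain ⟨μ, hμ⟩ := exists_isLeadExp (p := p.1) fun h => hne (Subtype.ext h)
      exact mem_support_iff.mp hμ.1 (congrFun hp ⟨μ, p.1, p.2, hμ⟩)
    have := LinearMap.finrank_le_finrank_of_injective hφ
    rwa [Module.finrank_fintype_fun_eq_card] at this
  · choose p hp hlead using fun μ : leadExps V => μ.2
    have hli : LinearIndependent K fun μ : leadExps V => (⟨p μ, hp μ⟩ : V) := by
      rw [Fintype.linearIndependent_iff]
      intro c hc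
      by_contra! hcon
      obtain ⟨μ₁, hμ₁⟩ := hcon
      obtain ⟨μ, hμ, hmax⟩ := exists_drlLT_max
        ((Finset.univ.filter fun μ : leadExps V => c μ ≠ 0).image Subtype.val)
        (Finset.image_nonempty.mpr ⟨μ₁, by simpa using hμ₁⟩)
      obtain ⟨μ', hμ', rfl⟩ := Finset.mem_image.mp hμ
      have h1 : ∑ ν, c ν • p ν = 0 := by
        simpa using congrArg V.subtype hc
      have h2 := congrArg (coeff μ'.1) h1
      rw [coeff_sum, coeff_zero, Finset.sum_eq_single μ'] at h2
      · rw [coeff_smul, smul_eq_mul] at h2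
        exact mul_ne_zero (by simpa using hμ') (mem_support_iff.mp (hlead μ').1) h2
      · intro ν _ hν
        by_cases h0 : c ν = 0
        · rw [h0, zero_smul, coeff_zero]
        · rw [coeff_smul, (hlead ν).coeff_eq_zero, smul_zero]
          exact hmax ν.1 (Finset.mem_image_of_mem _ (by simpa using h0))
            fun h => hν (Subtype.ext h)
      · exact fun h => absurd (Finset.mem_univ _) h
    exact hli.fintype_card_le_finrank

theorem homogeneousSubmodule_le_of_leadExps {n : ℕ} {K : Type*} [Field K] {t : ℕ}
    {V : Submodule K (MvPolynomial (Fin n) K)} (hV : V ≤ homogeneousSubmodule (Fin n) K t)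
    (h : ∀ μ, expDeg μ = t → μ ∈ leadExps V) : homogeneousSubmodule (Fin n) K t ≤ V := by
  refine (Submodule.eq_of_le_of_finrank_eq hV ?_).ge
  rw [finrank_eq_ncard_leadExps hV, finrank_homogeneousSubmodule]
  congr 1
  exact (leadExps_subset hV).antisymm h

theorem exists_le_expDeg_eq {n t : ℕ} (b : Fin n →₀ ℕ) (h : t ≤ expDeg b) :
    ∃ a ≤ b, expDeg a = t := by
  exact Finsupp.exists_le_degree_eq b t h

theorem monomial_mem_of_le {σ K : Type*} [CommRing K] {M : Ideal (MvPolynomial σ K)}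
    {μ ν : σ →₀ ℕ} (hν : monomial ν (1 : K) ∈ M) (h : ν ≤ μ) : monomial μ (1 : K) ∈ M := by
  have h1 : monomial μ (1 : K) = monomial (μ - ν) 1 * monomial ν 1 := by
    rw [monomial_mul, tsub_add_cancel_of_le h, one_mul]
  rw [h1]
  exact M.mul_mem_left _ hν

theorem initialIdeal_mono {n : ℕ} {K : Type*} [CommRing K] {I J : Ideal (MvPolynomial (Fin n) K)}
    (h : I ≤ J) : initialIdeal I ≤ initialIdeal J :=
  Ideal.span_mono fun _ ⟨p, hp, hm⟩ => ⟨p, h hp, hm⟩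

theorem embExp_mono {n : ℕ} {a b : Fin n →₀ ℕ} (h : a ≤ b) : embExp a ≤ embExp b := by
  intro i
  refine Fin.lastCases ?_ (fun i => ?_) i
  · rw [embExp_last, embExp_last]
  · rw [embExp_castSucc, embExp_castSucc]
    exact h i

theorem zShift_mono {n k l : ℕ} {μ ν : Fin (n + 1) →₀ ℕ} (h : μ ≤ ν) (hkl : k ≤ l) :
    zShift k μ ≤ zShift l ν :=
  add_le_add h (Finsupp.single_mono hkl)

theorem zShift_zero {n : ℕ} (μ : Fin (n + 1) →₀ ℕ) : zShift 0 μ = μ := by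
  rw [zShift, Finsupp.single_zero, add_zero]

theorem le_zShift {n : ℕ} (k : ℕ) (μ : Fin (n + 1) →₀ ℕ) : μ ≤ zShift k μ :=
  le_self_add

theorem embExp_restrictExp {n : ℕ} {μ : Fin (n + 1) →₀ ℕ} (h : μ (Fin.last n) = 0) :
    embExp (restrictExp μ) = μ := by
  have h1 := zShift_embExp_restrictExp μ
  rwa [h, zShift_zero] at h1

theorem drlLT_of_drlLT_embExp {n : ℕ} {a b : Fin n →₀ ℕ} (h : DrlLT (embExp a) (embExp b)) :
    DrlLT a b := by
  have hne : a ≠ b := by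
    rintro rfl
    exact DrlLT.irrefl _ h
  exact (drlLT_or_drlLT_of_ne hne).resolve_right fun h' => h.asymm h'.embExp

theorem projMap_surjective (K : Type*) [CommRing K] (n : ℕ) :
    Function.Surjective (projMap K n) := fun p => ⟨_, projMap_rename p⟩

/-- The initial ideal of the reduction modulo the last variable. -/
theorem monomial_mem_initialIdeal_map_projMap_iff {n : ℕ} {K : Type*} [Field K]
    {I : Ideal (MvPolynomial (Fin (n + 1)) K)} (hI : HasComponents I) {b : Fin n →₀ ℕ} :
    monomial b (1 : K) ∈ initialIdeal (I.map (projMap K n)) ↔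
      monomial (embExp b) (1 : K) ∈ initialIdeal I := by
  rw [monomial_mem_initialIdeal_iff, monomial_mem_initialIdeal_iff]
  constructor
  · rintro ⟨q, hq, hlead⟩
    obtain ⟨p, hp, rfl⟩ := (Ideal.mem_map_iff_of_surjective _ (projMap_surjective K n)).mp hq
    refine ⟨homogeneousComponent (expDeg b) p, hI p hp _, ?_, fun ν hν hne => ?_⟩
    · rw [mem_support_iff, coeff_homogeneousComponent, ← expDeg_eq_degree, expDeg_embExp,
        if_pos rfl, ← coeff_projMap]
      exact mem_support_iff.mp hlead.1
    · rw [mem_support_iff, coeff_homogeneousComponent, ← expDeg_eq_degree] at hν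
      obtain ⟨hd, hν⟩ := ite_ne_right_iff.mp hν
      rcases Nat.eq_zero_or_pos (ν (Fin.last n)) with h0 | h0
      · have h1 := embExp_restrictExp h0
        rw [← h1] at hν hne ⊢
        rw [← coeff_projMap] at hν
        exact (hlead.2 _ (mem_support_iff.mpr hν) fun h => hne (congrArg embExp h)).embExp
      · refine drlLT_of_last_lt (by rw [hd, expDeg_embExp]) ?_
        rwa [embExp_last]
  · rintro ⟨p, hp, hlead⟩
    refine ⟨projMap K n p, Ideal.mem_map_of_mem _ hp, ?_, fun ν hν hne => ?_⟩
    · rw [mem_support_iff, coeff_projMap]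
      exact mem_support_iff.mp hlead.1
    · rw [mem_support_iff, coeff_projMap] at hν
      exact drlLT_of_drlLT_embExp
        (hlead.2 _ (mem_support_iff.mpr hν) fun h => hne (embExp_injective h))

theorem sub_rename_projMap_mem {n : ℕ} {K : Type*} [CommRing K]
    (p : MvPolynomial (Fin (n + 1)) K) :
    p - rename Fin.castSucc (projMap K n p) ∈
      (Ideal.span {X (Fin.last n)} : Ideal (MvPolynomial (Fin (n + 1)) K)) := by
  induction p using MvPolynomial.induction_on' with
  | add p q hp hq =>
    have h1 : projMap K n (p + q) = projMap K n p + projMap K n q := map_add _ p q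
    rw [h1, map_add, add_sub_add_comm]
    exact (Ideal.span {X (Fin.last n)}).add_mem hp hq
  | monomial ν a =>
    rw [← zShift_embExp_restrictExp ν, monomial_zShift, map_mul, map_pow, projMap_X_last,
      monomial_embExp, projMap_rename]
    by_cases h0 : ν (Fin.last n) = 0
    · rw [h0, pow_zero, pow_zero, one_mul, one_mul, sub_self]
      exact Ideal.zero_mem _
    · rw [zero_pow h0, zero_mul, map_zero, sub_zero]
      exact Ideal.mem_span_singleton.mpr ((dvd_pow_self _ h0).mul_right _)

theorem mem_sup_X_last_of_projMap_mem {n : ℕ} {K : Type*} [CommRing K]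
    {I : Ideal (MvPolynomial (Fin (n + 1)) K)} {p : MvPolynomial (Fin (n + 1)) K}
    (h : projMap K n p ∈ I.map (projMap K n)) : p ∈ I ⊔ Ideal.span {X (Fin.last n) ^ 1} := by
  obtain ⟨q, hq, hqp⟩ := (Ideal.mem_map_iff_of_surjective _ (projMap_surjective K n)).mp h
  have h1 := sub_rename_projMap_mem (p - q)
  rw [map_sub, hqp, sub_self, map_zero, sub_zero] at h1
  rw [pow_one, ← add_sub_cancel q p]
  exact Submodule.add_mem_sup hq h1

theorem coeff_X_last_pow_mul_of_lt {n k : ℕ} {K : Type*} [CommRing K]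
    (r : MvPolynomial (Fin (n + 1)) K) {ν : Fin (n + 1) →₀ ℕ} (h : ν (Fin.last n) < k) :
    coeff ν (X (Fin.last n) ^ k * r) = 0 := by
  rw [X_pow_eq_monomial, coeff_monomial_mul', if_neg]
  rw [Finsupp.single_le_iff]
  exact h.not_ge

theorem isLeadExp_monomial_sub {n t : ℕ} {K : Type*} [Field K] {μ : Fin (n + 1) →₀ ℕ}
    {r : MvPolynomial (Fin (n + 1)) K} (hμ : expDeg μ = t)
    (hr : (X (Fin.last n) ^ (μ (Fin.last n) + 1) * r).IsHomogeneous t) :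
    IsLeadExp (monomial μ (1 : K) - X (Fin.last n) ^ (μ (Fin.last n) + 1) * r) μ := by
  classical
  constructor
  · rw [mem_support_iff, coeff_sub, coeff_X_last_pow_mul_of_lt r (Nat.lt_succ_self _),
      coeff_monomial, if_pos rfl, sub_zero]
    exact one_ne_zero
  · intro ν hν hne
    rw [mem_support_iff, coeff_sub, coeff_monomial, if_neg hne.symm, zero_sub, neg_ne_zero] at hν
    refine drlLT_of_last_lt ?_ ?_
    · rw [expDeg_eq_of_mem_support hr (mem_support_iff.mpr hν), hμ]
    · by_contra hcon
      exact hν (coeff_X_last_pow_mul_of_lt r (by omega))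

theorem isLeadExp_monomial {n : ℕ} {K : Type*} [Field K] (μ : Fin n →₀ ℕ) :
    IsLeadExp (monomial μ (1 : K)) μ := by
  classical
  constructor
  · rw [mem_support_iff, coeff_monomial, if_pos rfl]
    exact one_ne_zero
  · intro ν hν hne
    rw [mem_support_iff, coeff_monomial, if_neg hne.symm] at hν
    exact absurd rfl hν

/-- Monomials `z ^ k * b` of high degree lie in the initial ideal of a generic complete
intersection. -/
theorem monomial_zShift_mem_initialIdeal_of_generic {F K : Type*} [Field F] [Field K]
    [Algebra F K] {n : ℕ} {e : Fin (n + 1) → ℕ} {f : Fin (n + 1) → MvPolynomial (Fin (n + 1)) K}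
    (hf : IsGenericFamily F e f) {k : ℕ} {b : Fin n →₀ ℕ}
    (h : ∑ i, e i ≤ 2 * expDeg b + k + n) :
    monomial (zShift k (embExp b)) (1 : K) ∈ initialIdeal (Ideal.span (Set.range f)) := by
  have hd : expDeg (zShift k (embExp b)) = expDeg b + k := by rw [expDeg_zShift, expDeg_embExp]
  have hl : zShift k (embExp b) (Fin.last n) = k := by rw [zShift_last, embExp_last, zero_add]
  have hp : (monomial (zShift k (embExp b)) (1 : K)).IsHomogeneous (expDeg b + k) :=
    isHomogeneous_monomial _ hd
  rw [monomial_mem_initialIdeal_iff]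
  obtain h1 | ⟨s, hs, r, hr, h1⟩ := exists_of_mem_sup_span_singleton
    (hasComponents_span_range hf.1) (isHomogeneous_X_pow (Fin.last n) (k + 1)) hp
    (mem_sup_X_last_pow_of_generic n hf (expDeg b + k) (k + 1) (by omega) _ hp)
  · exact ⟨_, h1, isLeadExp_monomial _⟩
  · refine ⟨_, h1, ?_⟩
    have h2 := isLeadExp_monomial_sub (r := r) hd (by
      rw [hl, ← hs, add_comm s]
      exact (isHomogeneous_X_pow (Fin.last n) (k + 1)).mul hr)
    rwa [hl] at h2

/-- In low degree, factors of the last variable can be cancelled in the initial ideal of a generic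
complete intersection. -/
theorem monomial_embExp_mem_initialIdeal_of_zShift {F K : Type*} [Field F] [Field K]
    [Algebra F K] {n : ℕ} {e : Fin (n + 1) → ℕ} (he : ∀ i, 1 ≤ e i)
    {f : Fin (n + 1) → MvPolynomial (Fin (n + 1)) K}
    (hf : IsGenericFamily F e f) {k : ℕ} {b : Fin n →₀ ℕ}
    (h : 2 * expDeg b + k + (n + 1) ≤ ∑ i, e i)
    (hb : monomial (zShift k (embExp b)) (1 : K) ∈ initialIdeal (Ideal.span (Set.range f))) :
    monomial (embExp b) (1 : K) ∈ initialIdeal (Ideal.span (Set.range f)) := by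
  have hd : expDeg (zShift k (embExp b)) = expDeg b + k := by rw [expDeg_zShift, expDeg_embExp]
  have hl : zShift k (embExp b) (Fin.last n) = k := by rw [zShift_last, embExp_last, zero_add]
  rw [monomial_mem_initialIdeal_iff_leadExps (hasComponents_span_range hf.1), hd] at hb
  obtain ⟨p, hp, hlead⟩ := hb
  have hmod : p.modMonomial (Finsupp.single (Fin.last n) k) = 0 := by
    ext ν
    rw [coeff_zero]
    by_cases hν : Finsupp.single (Fin.last n) k ≤ ν
    · exact coeff_modMonomial_of_le _ hν
    · rw [coeff_modMonomial_of_not_le _ hν]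
      rw [Finsupp.single_le_iff, not_le] at hν
      by_contra hcon
      refine hcon (hlead.coeff_eq_zero (drlLT_of_last_lt ?_ (by rwa [hl])))
      rw [hd, expDeg_eq_of_mem_support hp.2 (mem_support_iff.mpr hcon)]
  have hdiv := divMonomial_add_modMonomial p (Finsupp.single (Fin.last n) k)
  rw [hmod, add_zero] at hdiv
  set q := p.divMonomial (Finsupp.single (Fin.last n) k) with hq
  have hcoeff : ∀ ν, coeff ν q = coeff (zShift k ν) p := fun ν => by
    rw [zShift, add_comm ν]
    exact coeff_divMonomial _ _ _
  have hqhom : q.IsHomogeneous (expDeg b) := by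
    intro ν hν
    rw [hcoeff] at hν
    have h1 := expDeg_eq_of_mem_support hp.2 (mem_support_iff.mpr hν)
    rw [expDeg_zShift] at h1
    have h2 : expDeg ν = expDeg b := by omega
    rw [← h2, expDeg_eq_degree, Finsupp.degree_eq_weight_one]
    rfl
  rw [monomial_mem_initialIdeal_iff]
  refine ⟨q, mem_of_X_last_pow_mul_mem he hf h hqhom ?_, ?_, fun ν hν hne => ?_⟩
  · rw [X_pow_eq_monomial, hdiv]
    exact hp.1
  · rw [mem_support_iff, hcoeff]
    exact mem_support_iff.mp hlead.1
  · rw [mem_support_iff, hcoeff] at hν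
    have h1 := hlead.2 _ (mem_support_iff.mpr hν) fun h => hne (add_right_cancel h)
    refine (drlLT_or_drlLT_of_ne hne).resolve_right fun h3 => h1.asymm ?_
    rw [zShift, zShift, add_comm (embExp b), add_comm ν]
    exact h3.add_left _

theorem colonPart_map_projMap {n D i : ℕ} {K : Type*} [CommRing K]
    {I : Ideal (MvPolynomial (Fin (n + 1)) K)} (hI : HasComponents I)
    {g : MvPolynomial (Fin (n + 1)) K} (hg : g.IsHomogeneous D)
    (hreg : ∀ p : MvPolynomial (Fin (n + 1)) K, p.IsHomogeneous i → g * p ∈ I → p ∈ I)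
    (hinj : ∀ s, s + 1 = D + i → ∀ r : MvPolynomial (Fin (n + 1)) K, r.IsHomogeneous s →
      X (Fin.last n) ^ 1 * r ∈ I ⊔ Ideal.span {g} → r ∈ I ⊔ Ideal.span {g}) :
    colonPart (I.map (projMap K n)) (projMap K n g) i = homPart (I.map (projMap K n)) i := by
  refine le_antisymm (fun q hq => ⟨?_, hq.2⟩) (homPart_le_colonPart _ _ i)
  have hp : (rename Fin.castSucc q).IsHomogeneous i := hq.2.rename_isHomogeneous
  have hpq := projMap_rename q
  set p := rename Fin.castSucc q
  have hgp : (g * p).IsHomogeneous (D + i) := hg.mul hp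
  have hmem : g * p ∈ I ⊔ Ideal.span {X (Fin.last n) ^ 1} := by
    refine mem_sup_X_last_of_projMap_mem ?_
    have h1 : projMap K n (g * p) = projMap K n g * projMap K n p := map_mul _ g p
    rw [h1, hpq]
    exact hq.1
  suffices h : p ∈ I ⊔ Ideal.span {X (Fin.last n)} by
    obtain ⟨a, ha, b, hb, hab⟩ := Submodule.mem_sup.mp h
    obtain ⟨c, rfl⟩ := Ideal.mem_span_singleton'.mp hb
    rw [← hpq, ← hab]
    have h1 : projMap K n (a + c * X (Fin.last n)) = projMap K n a := by
      rw [map_add, map_mul, projMap_X_last, mul_zero, add_zero]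
    rw [h1]
    exact Ideal.mem_map_of_mem _ ha
  obtain h1 | ⟨s, hs, r, hr, h1⟩ := exists_of_mem_sup_span_singleton hI
    (isHomogeneous_X_pow (Fin.last n) 1) hgp hmem
  · exact Ideal.mem_sup_left (hreg p hp h1)
  have hr' : r ∈ I ⊔ Ideal.span {g} := by
    refine hinj s hs r hr ?_
    rw [← sub_sub_self (g * p) (X (Fin.last n) ^ 1 * r)]
    exact Ideal.sub_mem _ (Ideal.mem_sup_right (Ideal.mul_mem_right _ _ (Ideal.subset_span rfl)))
      (Ideal.mem_sup_left h1)
  obtain h2 | ⟨s', hs', r', hr', h2⟩ := exists_of_mem_sup_span_singleton hI hg hr hr'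
  · refine Ideal.mem_sup_left (hreg p hp ?_)
    rw [← sub_add_cancel (g * p) (X (Fin.last n) ^ 1 * r)]
    exact I.add_mem h1 (I.mul_mem_left _ h2)
  · have h3 : p - X (Fin.last n) * r' ∈ I := by
      refine hreg _ (hp.sub ?_) ?_
      · have h4 := (isHomogeneous_X K (Fin.last n)).mul hr'
        rwa [show 1 + s' = i by omega] at h4
      · rw [show g * (p - X (Fin.last n) * r') = (g * p - X (Fin.last n) ^ 1 * r) +
          X (Fin.last n) * (r - g * r') by ring]
        exact I.add_mem h1 (I.mul_mem_left _ h2)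
    rw [← sub_add_cancel p (X (Fin.last n) * r')]
    exact Submodule.add_mem_sup h3 (Ideal.mul_mem_right _ _ (Ideal.subset_span rfl))

theorem stdMon_finite {n : ℕ} {K : Type*} [CommRing K] (I : Ideal (MvPolynomial (Fin n) K))
    (t : ℕ) : (stdMon I t).Finite :=
  (finite_setOf_expDeg_eq n t).subset fun _ h => h.1

theorem ncard_stdMon_inter_initialIdeal {n : ℕ} {K : Type*} [Field K]
    {I I' : Ideal (MvPolynomial (Fin n) K)} (hI : HasComponents I) (hI' : HasComponents I')
    (h : I ≤ I') (t : ℕ) :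
    {μ ∈ stdMon I t | monomial μ (1 : K) ∈ initialIdeal I'}.ncard +
      Module.finrank K (homPart I t) = Module.finrank K (homPart I' t) := by
  rw [finrank_eq_ncard_leadExps (homPart_le I t), finrank_eq_ncard_leadExps (homPart_le I' t)]
  have h1 : leadExps (homPart I t) ⊆ leadExps (homPart I' t) := fun μ ⟨p, hp, hμ⟩ =>
    ⟨p, homPart_mono h t hp, hμ⟩
  have h2 : {μ ∈ stdMon I t | monomial μ (1 : K) ∈ initialIdeal I'} =
      leadExps (homPart I' t) \ leadExps (homPart I t) := by
    ext μ
    constructor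
    · rintro ⟨⟨rfl, hμ⟩, hμ'⟩
      rw [monomial_mem_initialIdeal_iff_leadExps hI] at hμ
      rw [monomial_mem_initialIdeal_iff_leadExps hI'] at hμ'
      exact ⟨hμ', hμ⟩
    · rintro ⟨hμ', hμ⟩
      obtain rfl : expDeg μ = t := leadExps_subset (homPart_le I' t) hμ'
      rw [← monomial_mem_initialIdeal_iff_leadExps hI] at hμ
      rw [← monomial_mem_initialIdeal_iff_leadExps hI'] at hμ'
      exact ⟨⟨rfl, hμ⟩, hμ'⟩
  rw [h2]
  exact Set.ncard_sdiff_add_ncard_of_subset h1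
    ((finite_setOf_expDeg_eq n t).subset (leadExps_subset (homPart_le I' t)))

theorem ncard_stdMon_add_finrank {n : ℕ} {K : Type*} [Field K]
    {I : Ideal (MvPolynomial (Fin n) K)} (hI : HasComponents I) (t : ℕ) :
    (stdMon I t).ncard + Module.finrank K (homPart I t) =
      Module.finrank K (homogeneousSubmodule (Fin n) K t) := by
  have h1 := ncard_stdMon_inter_initialIdeal hI (I' := ⊤) (fun _ _ _ => trivial) le_top t
  have h2 : homPart (⊤ : Ideal (MvPolynomial (Fin n) K)) t = homogeneousSubmodule (Fin n) K t :=
    le_antisymm (homPart_le _ _) fun p hp => ⟨trivial, hp⟩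
  have h3 : {μ ∈ stdMon I t | monomial μ (1 : K) ∈ initialIdeal (⊤ : Ideal _)} = stdMon I t :=
    Set.sep_eq_self_iff_mem_true.mpr fun μ _ =>
      monomial_mem_initialIdeal_iff.mpr ⟨_, trivial, isLeadExp_monomial μ⟩
  rwa [h2, h3] at h1

/-- The new initial monomials contributed by a form that is injective in degree `i`. -/
theorem ncard_stdMon_inter_initialIdeal_of_colonPart {n D i : ℕ} {K : Type*} [Field K]
    {J : Ideal (MvPolynomial (Fin n) K)} (hJ : HasComponents J) {g : MvPolynomial (Fin n) K}
    (hg : g.IsHomogeneous D) (hcolon : colonPart J g i = homPart J i) :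
    {μ ∈ stdMon J (D + i) | monomial μ (1 : K) ∈ initialIdeal (J ⊔ Ideal.span {g})}.ncard =
      (stdMon J i).ncard := by
  have h1 := finrank_homPart_sup_span_singleton hJ hg i
  have h2 := ncard_stdMon_inter_initialIdeal hJ (hJ.sup (hasComponents_span_singleton hg))
    le_sup_left (D + i)
  have h3 := ncard_stdMon_add_finrank hJ i
  rw [hcolon, add_comm i] at h1
  omega

/-- The largest standard monomial in the degree of an additional generic form becomes a leading
monomial. -/
theorem max_stdMon_mem_initialIdeal {F K : Type*} [Field F] [Field K] [Algebra F K]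
    {n r D : ℕ} {d : Fin r → ℕ} {f : Fin r → MvPolynomial (Fin n) K} {g : MvPolynomial (Fin n) K}
    (hfg : IsGenericFamily F (Fin.snoc d D : Fin (r + 1) → ℕ)
      (Fin.snoc f g : Fin (r + 1) → MvPolynomial (Fin n) K))
    {J : Ideal (MvPolynomial (Fin n) K)} (hJ : J = Ideal.span (Set.range f))
    {μ₀ : Fin n →₀ ℕ} (hμ₀ : expDeg μ₀ = D)
    (hmax : ∀ ν ∈ stdMon J D, ν ≠ μ₀ → DrlLT ν μ₀) :
    monomial μ₀ (1 : K) ∈ initialIdeal (Ideal.span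
      (Set.range (Fin.snoc f g : Fin (r + 1) → MvPolynomial (Fin n) K))) := by
  have hf : ∀ i, (f i).IsHomogeneous (d i) := fun i => by
    have := hfg.1 i.castSucc
    rwa [Fin.snoc_castSucc, Fin.snoc_castSucc] at this
  have hJc : HasComponents J := hJ ▸ hasComponents_span_range hf
  let f' : Fin (r + 1) → MvPolynomial (Fin n) K := Fin.snoc f (monomial μ₀ 1)
  have hf' : ∀ i, (f' i).IsHomogeneous ((Fin.snoc d D : Fin (r + 1) → ℕ) i) := by
    intro i
    refine Fin.lastCases ?_ (fun i => ?_) i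
    · simp only [f', Fin.snoc_last]
      exact isHomogeneous_monomial _ hμ₀
    · simp only [f', Fin.snoc_castSucc]
      exact hf i
  let Z : Set (Fin n →₀ ℕ) := {ν | expDeg ν = D ∧ DrlLT ν μ₀}
  have hZ : Submodule.span K ((fun μ => monomial μ (1 : K)) '' Z) ≤
      homogeneousSubmodule (Fin n) K D := by
    rw [Submodule.span_le]
    rintro _ ⟨ν, hν, rfl⟩
    exact isHomogeneous_monomial _ hν.1
  have hspec : homogeneousSubmodule (Fin n) K D ≤ homPart (Ideal.span (Set.range f')) D ⊔
      Submodule.span K ((fun μ => monomial μ (1 : K)) '' Z) := by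
    refine homogeneousSubmodule_le_of_leadExps (sup_le (homPart_le _ _) hZ) fun μ hμ => ?_
    by_cases h1 : monomial μ (1 : K) ∈ initialIdeal J
    · rw [monomial_mem_initialIdeal_iff_leadExps hJc, hμ] at h1
      obtain ⟨p, hp, hlead⟩ := h1
      refine ⟨p, Submodule.mem_sup_left (homPart_mono ?_ D hp), hlead⟩
      rw [hJ, Ideal.span_le]
      rintro _ ⟨i, rfl⟩
      exact Ideal.subset_span ⟨i.castSucc, by simp only [f', Fin.snoc_castSucc]⟩
    · by_cases h2 : μ = μ₀
      · subst h2
        refine ⟨monomial μ 1, Submodule.mem_sup_left ⟨Ideal.subset_span ⟨Fin.last r, ?_⟩,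
          isHomogeneous_monomial _ hμ⟩, isLeadExp_monomial μ⟩
        simp only [f', Fin.snoc_last]
      · exact ⟨monomial μ 1, Submodule.mem_sup_right (Submodule.subset_span
          ⟨μ, ⟨hμ, hmax μ ⟨hμ, h1⟩ h2⟩, rfl⟩), isLeadExp_monomial μ⟩
  have hgen := homogeneousSubmodule_le_of_generic hfg hf' D Z (fun _ h => h.1) hspec
  obtain ⟨a, ha, b, hb, hab⟩ := Submodule.mem_sup.mp
    (hgen (isHomogeneous_monomial (1 : K) hμ₀ : monomial μ₀ (1 : K) ∈ _))
  have hbZ : ∀ ν ∉ Z, coeff ν b = 0 := by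
    intro ν hν
    have h1 : Submodule.span K ((fun μ => monomial μ (1 : K)) '' Z) ≤
        LinearMap.ker (lcoeff K ν) := by
      classical
      rw [Submodule.span_le]
      rintro _ ⟨κ, hκ, rfl⟩
      change coeff ν (monomial κ (1 : K)) = 0
      rw [coeff_monomial, if_neg]
      rintro rfl
      exact hν hκ
    exact h1 hb
  rw [monomial_mem_initialIdeal_iff]
  refine ⟨a, ha.1, ?_, fun ν hν hne => ?_⟩
  · classical
    rw [mem_support_iff, eq_sub_of_add_eq hab, coeff_sub,
      hbZ μ₀ fun h => DrlLT.irrefl _ h.2, coeff_monomial, if_pos rfl, sub_zero]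
    exact one_ne_zero
  · classical
    by_contra hcon
    rw [mem_support_iff, eq_sub_of_add_eq hab, coeff_sub, hbZ ν fun h => hcon h.2,
      coeff_monomial, if_neg hne.symm, sub_zero] at hν
    exact hν rfl

theorem zero_mem_stdMon {ι K : Type*} [Fintype ι] [Field K] {n : ℕ} {d : ι → ℕ}
    {f : ι → MvPolynomial (Fin n) K} (hf : ∀ i, (f i).IsHomogeneous (d i)) (hd : ∀ i, 1 ≤ d i) :
    (0 : Fin n →₀ ℕ) ∈ stdMon (Ideal.span (Set.range f)) 0 := by
  have h0 : expDeg (0 : Fin n →₀ ℕ) = 0 := by rw [expDeg_eq_sum]; simp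
  refine ⟨h0, ?_⟩
  rw [monomial_mem_initialIdeal_iff_leadExps (hasComponents_span_range hf), h0]
  rintro ⟨p, hp, hlead⟩
  refine hlead.ne_zero ?_
  rw [homPart_span_range hf] at hp
  have hempty : (Set.range fun x : { x : ι × (Fin n →₀ ℕ) // expDeg x.2 + d x.1 = 0 } =>
      monomial x.1.2 (1 : K) * f x.1.1) = ∅ := by
    rw [Set.range_eq_empty_iff]
    refine ⟨fun x => ?_⟩
    have := hd x.1.1
    have := x.2
    omega
  rw [hempty, Submodule.span_empty] at hp
  exact hp

theorem stdMon_of_le {n s : ℕ} {K : Type*} [CommRing K] {J : Ideal (MvPolynomial (Fin n) K)}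
    {a b : Fin n →₀ ℕ} (hb : b ∈ stdMon J s) (h : a ≤ b) : a ∈ stdMon J (expDeg a) :=
  ⟨rfl, fun ha => hb.2 (monomial_mem_of_le ha h)⟩

/-- Generators of the initial ideal of an ideal in which powers of the last variable behave as
they do modulo a generic complete intersection of odd socle defect. -/
theorem initialIdeal_eq_sup_span {n D m δ : ℕ} {K : Type*} [Field K]
    {I I' : Ideal (MvPolynomial (Fin (n + 1)) K)} {J : Ideal (MvPolynomial (Fin n) K)}
    (hle : I ≤ I') (hδ : δ = D + 2 * m + 1)
    (hJ : ∀ b, monomial b (1 : K) ∈ initialIdeal J → monomial (embExp b) (1 : K) ∈ initialIdeal I)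
    (hlarge : ∀ k b, δ + D ≤ 2 * expDeg b + k →
      monomial (zShift k (embExp b)) (1 : K) ∈ initialIdeal I')
    (hsmall : ∀ k b, 2 * expDeg b + k < δ + D →
      monomial (zShift k (embExp b)) (1 : K) ∈ initialIdeal I' →
      monomial (embExp b) (1 : K) ∈ initialIdeal I')
    (hlow : ∀ b, b ∈ stdMon J (expDeg b) → expDeg b < D →
      monomial (embExp b) (1 : K) ∉ initialIdeal I')
    {μ₀ : Fin n →₀ ℕ}
    (hμ₀ : {b ∈ stdMon J D | monomial (embExp b) (1 : K) ∈ initialIdeal I'} = {μ₀}) :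
    initialIdeal I' = initialIdeal I ⊔ Ideal.span ((fun ν => monomial ν (1 : K)) ''
      ({embExp μ₀} ∪ (⋃ i ∈ Finset.Icc 1 m, embExp ''
          {b ∈ stdMon J (D + i) | monomial (embExp b) (1 : K) ∈ initialIdeal I'}) ∪
        embExp '' stdMon J (D + m + 1) ∪
        (⋃ k ∈ Finset.Icc 1 (m + 1), zShift (2 * k - 1) '' (embExp '' stdMon J (D + m + 1 - k))) ∪
        (⋃ j ∈ Finset.Icc 1 D, zShift (δ - D + 2 * j) '' (embExp '' stdMon J (D - j))))) := by
  have h0 : μ₀ ∈ {b ∈ stdMon J D | monomial (embExp b) (1 : K) ∈ initialIdeal I'} := by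
    rw [hμ₀]; rfl
  refine le_antisymm ?_ (sup_le (initialIdeal_mono hle) (Ideal.span_le.mpr ?_))
  · conv_lhs => rw [initialIdeal_eq_span_image I']
    refine Ideal.span_le.mpr ?_
    rintro _ ⟨μ, hμ, rfl⟩
    have hmem : monomial μ (1 : K) ∈ initialIdeal I' := monomial_mem_initialIdeal_iff.mpr hμ
    obtain ⟨k, b, rfl⟩ : ∃ k b, μ = zShift k (embExp b) :=
      ⟨_, _, (zShift_embExp_restrictExp μ).symm⟩
    change monomial (zShift k (embExp b)) (1 : K) ∈ _
    by_cases hbJ : monomial b (1 : K) ∈ initialIdeal J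
    · exact monomial_mem_of_le (Ideal.mem_sup_left (hJ b hbJ)) (le_zShift k _)
    have hb : b ∈ stdMon J (expDeg b) := ⟨rfl, hbJ⟩
    have key : ∀ {S : Set (Fin (n + 1) →₀ ℕ)} {ν : Fin (n + 1) →₀ ℕ}, ν ∈ S →
        ν ≤ zShift k (embExp b) → monomial (zShift k (embExp b)) (1 : K) ∈
          initialIdeal I ⊔ Ideal.span ((fun ν => monomial ν (1 : K)) '' S) := fun hν hνle =>
      monomial_mem_of_le (Ideal.mem_sup_right (Ideal.subset_span ⟨_, hν, rfl⟩)) hνle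
    by_cases hlg : δ + D ≤ 2 * expDeg b + k
    · obtain h | h := le_or_gt (D + m + 1) (expDeg b)
      · obtain ⟨a, hab, ha⟩ := exists_le_expDeg_eq b h
        exact key (Or.inl (Or.inl (Or.inr ⟨a, ha ▸ stdMon_of_le hb hab, rfl⟩)))
          ((embExp_mono hab).trans (le_zShift k _))
      obtain h' | h' := le_or_gt D (expDeg b)
      · refine key (ν := zShift (2 * (D + m + 1 - expDeg b) - 1) (embExp b))
          (Or.inl (Or.inr (Set.mem_iUnion₂.mpr ⟨D + m + 1 - expDeg b,
            Finset.mem_Icc.mpr ⟨by omega, by omega⟩, _, ⟨b, ?_, rfl⟩, rfl⟩)))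
          (zShift_mono le_rfl (by omega))
        rwa [show D + m + 1 - (D + m + 1 - expDeg b) = expDeg b by omega]
      · refine key (ν := zShift (δ - D + 2 * (D - expDeg b)) (embExp b))
          (Or.inr (Set.mem_iUnion₂.mpr ⟨D - expDeg b,
            Finset.mem_Icc.mpr ⟨by omega, by omega⟩, _, ⟨b, ?_, rfl⟩, rfl⟩))
          (zShift_mono le_rfl (by omega))
        rwa [show D - (D - expDeg b) = expDeg b by omega]
    · have hbI' := hsmall k b (by omega) hmem
      have hD : D ≤ expDeg b := not_lt.mp fun h => hlow b hb h hbI'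
      obtain h | h := hD.eq_or_lt
      · have hb0 : b ∈ {b ∈ stdMon J D | monomial (embExp b) (1 : K) ∈ initialIdeal I'} :=
          ⟨h ▸ hb, hbI'⟩
        rw [hμ₀] at hb0
        exact key (Or.inl (Or.inl (Or.inl (Or.inl (congrArg embExp hb0))))) (le_zShift k _)
      · refine key (Or.inl (Or.inl (Or.inl (Or.inr (Set.mem_iUnion₂.mpr ⟨expDeg b - D,
          Finset.mem_Icc.mpr ⟨by omega, by omega⟩, b, ⟨?_, hbI'⟩, rfl⟩))))) (le_zShift k _)
        rwa [show D + (expDeg b - D) = expDeg b by omega]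
  · rintro _ ⟨μ, (((hμ | hμ) | hμ) | hμ) | hμ, rfl⟩
    · rw [hμ]
      exact h0.2
    · obtain ⟨i, -, b, hb, rfl⟩ := Set.mem_iUnion₂.mp hμ
      exact hb.2
    · obtain ⟨b, hb, rfl⟩ := hμ
      have := hlarge 0 b (by rw [hb.1]; omega)
      rwa [zShift_zero] at this
    · obtain ⟨k, hk, _, ⟨b, hb, rfl⟩, rfl⟩ := Set.mem_iUnion₂.mp hμ
      rw [Finset.mem_Icc] at hk
      exact hlarge _ b (by rw [hb.1]; omega)
    · obtain ⟨j, hj, _, ⟨b, hb, rfl⟩, rfl⟩ := Set.mem_iUnion₂.mp hμ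
      rw [Finset.mem_Icc] at hj
      exact hlarge _ b (by rw [hb.1]; omega)

/-- description of `in(I,g)` when `d < δ` and `δ − d` is odd. -/
theorem stmt7 {F K : Type*} [Field F] [Field K] [Algebra F K] [Infinite K]
    {n : ℕ} (hn : 0 < n) (d : Fin n → ℕ) (hd : ∀ i, 1 ≤ d i) (hmono : Monotone d)
    (D : ℕ) (hdD : ∀ i, d i ≤ D)
    (f : Fin n → MvPolynomial (Fin (n + 1)) K) (g : MvPolynomial (Fin (n + 1)) K)
    (hfg : IsGenericSeq F (Fin.snoc d D) (Fin.snoc f g))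
    (I Ig : Ideal (MvPolynomial (Fin (n + 1)) K))
    (hI : I = Ideal.span (Set.range f)) (hIg : Ig = Ideal.span (Set.range (Fin.snoc f g)))
    (J : Ideal (MvPolynomial (Fin n) K)) (hJ : J = I.map (projMap K n))
    (δ istar : ℕ) (hδ : δ = (∑ j, d j) - n) (hDδ : D < δ) (histar : istar = (δ - D) / 2)
    (hodd : Odd (δ - D)) :
    ∃ T : ℕ → Set (Fin n →₀ ℕ),
      (∀ i ∈ Finset.Icc 1 istar,
        T i ⊆ stdMon J (D + i) ∧ (T i).ncard = (stdMon J i).ncard) ∧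
      ∃ μ0 ∈ stdMon J D, (∀ ν ∈ stdMon J D, ν ≠ μ0 → DrlLT ν μ0) ∧
        initialIdeal Ig =
          initialIdeal I ⊔ Ideal.span ((fun ν => monomial ν (1 : K)) ''
            ({embExp μ0} ∪ (⋃ i ∈ Finset.Icc 1 istar, embExp '' T i) ∪
              embExp '' stdMon J (D + istar + 1) ∪
              (⋃ k ∈ Finset.Icc 1 (istar + 1),
                zShift (2 * k - 1) '' (embExp '' stdMon J (D + istar + 1 - k))) ∪
              (⋃ j ∈ Finset.Icc 1 D,
                zShift (δ - D + 2 * j) '' (embExp '' stdMon J (D - j))))) := by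
  have hG : IsGenericFamily F (Fin.snoc d D : Fin (n + 1) → ℕ)
    (Fin.snoc f g : Fin (n + 1) → MvPolynomial (Fin (n + 1)) K) := hfg
  have hsum : ∑ i, (Fin.snoc d D : Fin (n + 1) → ℕ) i = ∑ j, d j + D := by
    rw [Fin.sum_univ_castSucc]
    simp only [Fin.snoc_castSucc, Fin.snoc_last]
  have hnd : n ≤ ∑ j, d j := by
    simpa using Finset.sum_le_sum fun j (_ : j ∈ Finset.univ) => hd j
  have hD1 : 1 ≤ D := (hd ⟨0, hn⟩).trans (hdD ⟨0, hn⟩)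
  have he : ∀ i, 1 ≤ (Fin.snoc d D : Fin (n + 1) → ℕ) i := fun i => by
    refine Fin.lastCases ?_ (fun i => ?_) i
    · rwa [Fin.snoc_last]
    · rw [Fin.snoc_castSucc]
      exact hd i
  have hδm : δ = D + 2 * istar + 1 := by
    obtain ⟨c, hc⟩ := hodd
    omega
  have hfh : ∀ i, (f i).IsHomogeneous (d i) := fun i => by
    simpa only [Fin.snoc_castSucc] using hG.1 i.castSucc
  have hgh : g.IsHomogeneous D := by simpa only [Fin.snoc_last] using hG.1 (Fin.last n)
  have hIc : HasComponents I := hI ▸ hasComponents_span_range hfh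
  have hIgc : HasComponents Ig := hIg ▸ hasComponents_span_range hG.1
  have hIgsup : Ig = I ⊔ Ideal.span {g} := by
    rw [hIg, hI, Fin.range_snoc, Set.insert_eq, Ideal.span_union, sup_comm]
  have hIseg : I = initialSegmentIdeal
      (Fin.snoc f g : Fin (n + 1) → MvPolynomial (Fin (n + 1)) K) (Fin.last n).val := by
    rw [hI, initialSegmentIdeal_eq_span_image]
    congr 1
    ext p
    constructor
    · rintro ⟨i, rfl⟩
      exact ⟨i.castSucc, i.isLt, Fin.snoc_castSucc ..⟩
    · rintro ⟨i, hi, rfl⟩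
      exact ⟨⟨i, hi⟩, (Fin.snoc_castSucc (α := fun _ => MvPolynomial (Fin (n + 1)) K)
        g f ⟨i.val, hi⟩).symm⟩
  have hJspan : J = Ideal.span (Set.range fun i => projMap K n (f i)) := by
    rw [hJ, hI, Ideal.map_span, ← Set.range_comp]
    rfl
  have hJc : HasComponents J :=
    hJspan ▸ hasComponents_span_range fun i => isHomogeneous_projMap (hfh i)
  have hJgsup : Ig.map (projMap K n) = J ⊔ Ideal.span {projMap K n g} := by
    rw [hIgsup, Ideal.map_sup, hJ, Ideal.map_span, Set.image_singleton]
  have hpg : (projMap K n g).IsHomogeneous D := isHomogeneous_projMap hgh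
  have hiff : ∀ b : Fin n →₀ ℕ, monomial (embExp b) (1 : K) ∈ initialIdeal Ig ↔
      monomial b (1 : K) ∈ initialIdeal (J ⊔ Ideal.span {projMap K n g}) := fun b => by
    rw [← hJgsup, monomial_mem_initialIdeal_map_projMap_iff hIgc]
  have hncard : ∀ i ≤ istar, {b ∈ stdMon J (D + i) |
      monomial (embExp b) (1 : K) ∈ initialIdeal Ig}.ncard = (stdMon J i).ncard := by
    intro i hi
    simp only [hiff]
    refine ncard_stdMon_inter_initialIdeal_of_colonPart hJc hpg ?_
    rw [hJ]
    refine colonPart_map_projMap hIc hgh (fun p hp hgp => ?_) fun s hs r hr hXr => ?_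
    · have hreg := (generic_hilbert_and_regular hG (n + 1) le_rfl).2 (Fin.last n)
        (Nat.lt_succ_self n) i
      rw [← hIseg, Fin.snoc_last] at hreg
      exact (hreg.le ⟨hgp, hp⟩).1
    · rw [← hIgsup, hIg] at hXr ⊢
      exact mem_of_X_last_pow_mul_mem he hG (by omega) hr hXr
  have hzero : stdMon J 0 = {0} := by
    refine Set.Subset.antisymm (fun b hb => ?_) (Set.singleton_subset_iff.mpr ?_)
    · exact (Finsupp.degree_eq_zero_iff b).mp hb.1
    · rw [hJspan]
      exact zero_mem_stdMon (fun i => isHomogeneous_projMap (hfh i)) hd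
  obtain ⟨ν₀, hν₀⟩ := Set.ncard_eq_one.mp
    ((hncard 0 (Nat.zero_le _)).trans (by rw [hzero, Set.ncard_singleton]))
  rw [add_zero] at hν₀
  have hν₀mem : ν₀ ∈ {b ∈ stdMon J D | monomial (embExp b) (1 : K) ∈ initialIdeal Ig} := by
    rw [hν₀]; rfl
  obtain ⟨μ₀, hμ₀, hmax⟩ := exists_drlLT_max (stdMon_finite J D).toFinset
    ⟨ν₀, (Set.Finite.mem_toFinset _).mpr hν₀mem.1⟩
  simp only [Set.Finite.mem_toFinset] at hμ₀ hmax
  have hμ₀Ig : monomial (embExp μ₀) (1 : K) ∈ initialIdeal Ig := by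
    have hGp : (fun i => projMap K n
        ((Fin.snoc f g : Fin (n + 1) → MvPolynomial (Fin (n + 1)) K) i)) =
        (Fin.snoc (fun i => projMap K n (f i)) (projMap K n g) :
          Fin (n + 1) → MvPolynomial (Fin n) K) := by
      funext i
      refine Fin.lastCases ?_ (fun i => ?_) i
      · simp only [Fin.snoc_last]
      · simp only [Fin.snoc_castSucc]
    have := max_stdMon_mem_initialIdeal (hGp ▸ hG.projMap) hJspan hμ₀.1 hmax
    rwa [Fin.range_snoc, Set.insert_eq, Ideal.span_union, sup_comm, ← hJspan, ← hiff] at this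
  have hT0 : {b ∈ stdMon J D | monomial (embExp b) (1 : K) ∈ initialIdeal Ig} = {μ₀} := by
    have : μ₀ ∈ {b ∈ stdMon J D | monomial (embExp b) (1 : K) ∈ initialIdeal Ig} := ⟨hμ₀, hμ₀Ig⟩
    rw [hν₀] at this ⊢
    rw [Set.mem_singleton_iff.mp this]
  refine ⟨fun i => {b ∈ stdMon J (D + i) | monomial (embExp b) (1 : K) ∈ initialIdeal Ig},
    fun i hi => ⟨fun b hb => hb.1, hncard i (Finset.mem_Icc.mp hi).2⟩, μ₀, hμ₀, hmax, ?_⟩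
  refine initialIdeal_eq_sup_span (hIgsup ▸ le_sup_left) hδm (fun b hb => ?_) (fun k b hk => ?_)
    (fun k b hk hb => ?_) (fun b hb hbD hbIg => ?_) hT0
  · rw [hJ] at hb
    exact (monomial_mem_initialIdeal_map_projMap_iff hIc).mp hb
  · rw [hIg]
    exact monomial_zShift_mem_initialIdeal_of_generic hG (by omega)
  · rw [hIg] at hb ⊢
    exact monomial_embExp_mem_initialIdeal_of_zShift he hG (by omega) hb
  · rw [hiff, monomial_mem_initialIdeal_iff_leadExps
      (hJc.sup (hasComponents_span_singleton hpg)), homPart_sup_span_singleton_of_lt hJc hpg hbD,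
      ← monomial_mem_initialIdeal_iff_leadExps hJc] at hbIg
    exact hb.2 hbIg
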